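/- arXiv:1708.06224 — 3 statements merged into one kernel-verified Lean document; each statement's English description precedes it below -/
import Mathlib

section
/- There exists a set C of 333 three-dimensional F₂-linear subspaces of F₂⁷ such that any two distinct members of C intersect in a subspace of dimension at most 1. In particular, A₂(7,4;3) ≥ 333, i.e., the maximum cardinality of a binary constant dimension code in F₂⁷ with codeword dimension 3 and minimum subspace distance 4 is at least 333. -/
/-- The ambient vector space `F₂⁷`. -/
abbrev V : Type := Fin 7 → ZMod 2

/-- `GL(7,F₂)` acts on the subspaces of `F₂⁷` by mapping each subspace to its image
under the associated linear automorphism. -/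
noncomputable instance : MulAction (GL (Fin 7) (ZMod 2)) (Submodule (ZMod 2) V) where
  smul M W := W.map (Matrix.mulVecLin (M : Matrix (Fin 7) (Fin 7) (ZMod 2)))
  one_smul W := by
    show W.map _ = W
    simp
  mul_smul M N W := by
    show W.map _ = (W.map _).map _
    rw [← Submodule.map_comp]
    simp [Matrix.mulVecLin_mul]

/-- `C` is a `(7,4;3)₂` constant dimension code: a set of `3`-dimensional subspaces of `F₂⁷`
any two distinct members of which intersect in a subspace of dimension at most `1`. -/
def IsCode (C : Set (Submodule (ZMod 2) V)) : Prop :=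
  (∀ W ∈ C, Module.finrank (ZMod 2) W = 3) ∧
  ∀ W₁ ∈ C, ∀ W₂ ∈ C, W₁ ≠ W₂ → Module.finrank (ZMod 2) ↥(W₁ ⊓ W₂) ≤ 1

open Pointwise in
/-- The automorphism group of `C`: the setwise stabilizer of `C` in `GL(7,F₂)`,
i.e. all `M` with `C · M = C`. -/
noncomputable def Aut (C : Set (Submodule (ZMod 2) V)) : Subgroup (GL (Fin 7) (ZMod 2)) :=
  MulAction.stabilizer (GL (Fin 7) (ZMod 2)) C

/-- `C` is invariant under every element of the subgroup `U` of `GL(7,F₂)`. -/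
def Invariant (U : Subgroup (GL (Fin 7) (ZMod 2))) (C : Set (Submodule (ZMod 2) V)) : Prop :=
  ∀ M ∈ U, ∀ W ∈ C, M • W ∈ C

/-- The vector of `F₂⁷` whose coordinates are the lowest seven binary digits of `n`. -/
def binaryVec (n : ℕ) : V := fun i => if n.testBit i then 1 else 0

lemma binaryVec_xor (m n : ℕ) : binaryVec (m ^^^ n) = binaryVec m + binaryVec n := by
  ext i
  simp only [binaryVec, Nat.testBit_xor, Pi.add_apply]
  cases m.testBit i <;> cases n.testBit i <;> decide

lemma binaryVec_zero : binaryVec 0 = 0 := by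
  ext i
  simp [binaryVec]

lemma injOn_binaryVec : Set.InjOn binaryVec {n | n < 2 ^ 7} := by
  intro m hm n hn h
  refine Nat.eq_of_testBit_eq fun i => ?_
  by_cases hi : i < 7
  · have hbit := congrFun h ⟨i, hi⟩
    simp only [binaryVec] at hbit
    cases hmi : m.testBit i <;> cases hni : n.testBit i <;> simp_all
  · have hpow : 2 ^ 7 ≤ 2 ^ i := Nat.pow_le_pow_right (by norm_num) (by omega)
    rw [Nat.testBit_lt_two_pow (lt_of_lt_of_le hm hpow),
      Nat.testBit_lt_two_pow (lt_of_lt_of_le hn hpow)]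

/-- The subspace of `F₂⁷` spanned by the binary vectors of three numbers. -/
def binarySpan (t : ℕ × ℕ × ℕ) : Submodule (ZMod 2) V :=
  Submodule.span (ZMod 2) {binaryVec t.1, binaryVec t.2.1, binaryVec t.2.2}

/-- The sums without carry of the nonempty subfamilies of three numbers. -/
def nonzeroSums (t : ℕ × ℕ × ℕ) : List ℕ :=
  [t.1, t.2.1, t.1 ^^^ t.2.1, t.2.2, t.1 ^^^ t.2.2, t.2.1 ^^^ t.2.2, t.1 ^^^ t.2.1 ^^^ t.2.2]

lemma mem_binarySpan {t : ℕ × ℕ × ℕ} {v : V} :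
    v ∈ binarySpan t ↔ ∃ n ∈ 0 :: nonzeroSums t, binaryVec n = v := by
  obtain ⟨a, b, c⟩ := t
  have hF : ∀ x : ZMod 2, x = 0 ∨ x = 1 := by decide
  simp only [binarySpan, Submodule.mem_span_triple, nonzeroSums, List.mem_cons, List.not_mem_nil,
    or_false, exists_eq_or_imp, exists_eq_left, binaryVec_xor, binaryVec_zero]
  constructor
  · rintro ⟨x, y, z, rfl⟩
    rcases hF x with rfl | rfl <;> rcases hF y with rfl | rfl <;> rcases hF z with rfl | rfl <;>
      simp
  · rintro (h | h | h | h | h | h | h | h)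
    · exact ⟨0, 0, 0, by simpa using h⟩
    · exact ⟨1, 0, 0, by simpa using h⟩
    · exact ⟨0, 1, 0, by simpa using h⟩
    · exact ⟨1, 1, 0, by simpa using h⟩
    · exact ⟨0, 0, 1, by simpa using h⟩
    · exact ⟨1, 0, 1, by simpa using h⟩
    · exact ⟨0, 1, 1, by simpa using h⟩
    · exact ⟨1, 1, 1, by simpa using h⟩

/-- Three numbers below `2 ^ 7` with linearly independent binary vectors. -/
def IsBinaryBasis (t : ℕ × ℕ × ℕ) : Prop :=
  (0 :: nonzeroSums t).Nodup ∧ ∀ n ∈ 0 :: nonzeroSums t, n < 2 ^ 7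

instance : DecidablePred IsBinaryBasis := fun t => by
  unfold IsBinaryBasis
  infer_instance

lemma IsBinaryBasis.finrank_binarySpan {t : ℕ × ℕ × ℕ} (ht : IsBinaryBasis t) :
    Module.finrank (ZMod 2) (binarySpan t) = 3 := by
  have hset : (binarySpan t : Set V) = binaryVec '' ((0 :: nonzeroSums t).toFinset : Set ℕ) := by
    ext v
    simp only [SetLike.mem_coe, mem_binarySpan, Set.mem_image, List.mem_toFinset]
  have hcard : Nat.card (binarySpan t) = 8 := by
    change Nat.card (binarySpan t : Set V) = 8
    rw [Nat.card_coe_set_eq, hset, Set.InjOn.ncard_image, Set.ncard_coe_finset,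
      List.toFinset_card_of_nodup ht.1]
    · rfl
    · refine injOn_binaryVec.mono fun n hn => ht.2 n ?_
      simpa only [Finset.mem_coe, List.mem_toFinset] using hn
  rw [Module.natCard_eq_pow_finrank (K := ZMod 2), Nat.card_zmod] at hcard
  exact Nat.pow_right_injective le_rfl (hcard.trans (by norm_num : 8 = 2 ^ 3))

/-- The number whose binary digits are the indicator function of `nonzeroSums t`. -/
def pointMask (t : ℕ × ℕ × ℕ) : ℕ := (nonzeroSums t).foldr (fun n m => 2 ^ n ||| m) 0

lemma testBit_pointMask {t : ℕ × ℕ × ℕ} {n : ℕ} (hn : n ∈ nonzeroSums t) :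
    (pointMask t).testBit n = true := by
  unfold pointMask
  generalize nonzeroSums t = l at hn
  induction l with
  | nil => exact absurd hn List.not_mem_nil
  | cons a l ih =>
    rw [List.foldr_cons, Nat.testBit_or, Bool.or_eq_true]
    rcases List.mem_cons.1 hn with h | h
    · rw [h]
      exact Or.inl Nat.testBit_two_pow_self
    · exact Or.inr (ih h)

/-- The number whose binary digit at `2 ^ 7 * m + n` tells whether `m` and `n` are distinct members
of `nonzeroSums t`, provided that these members are less than `2 ^ 7`. -/
def lineMask (t : ℕ × ℕ × ℕ) : ℕ :=
  (nonzeroSums t).foldr (fun n m => (pointMask t ^^^ 2 ^ n) <<< (2 ^ 7 * n) ||| m) 0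

lemma testBit_lineMask {t : ℕ × ℕ × ℕ} {m n : ℕ} (hm : m ∈ nonzeroSums t)
    (hn : n ∈ nonzeroSums t) (hmn : m ≠ n) : (lineMask t).testBit (2 ^ 7 * m + n) = true := by
  have hbit := testBit_pointMask hn
  unfold lineMask
  generalize nonzeroSums t = l at hm
  induction l with
  | nil => exact absurd hm List.not_mem_nil
  | cons a l ih =>
    rw [List.foldr_cons, Nat.testBit_or, Bool.or_eq_true]
    rcases List.mem_cons.1 hm with rfl | h
    · left
      rw [Nat.testBit_shiftLeft, Nat.add_sub_cancel_left, Nat.testBit_xor, hbit,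
        Nat.testBit_two_pow_of_ne hmn]
      simp
    · exact Or.inr (ih h)

/-- No binary digit is set both in two of the given numbers or both in one of them and in `u`. -/
def disjointMasks (u : ℕ) : List ℕ → Bool
  | [] => true
  | m :: l => u &&& m == 0 && disjointMasks (u ||| m) l

lemma pairwise_of_disjointMasks {u : ℕ} {l : List ℕ} (h : disjointMasks u l = true) :
    (u :: l).Pairwise fun m n => m &&& n = 0 := by
  induction l generalizing u with
  | nil => exact List.pairwise_singleton _ _
  | cons m l ih =>
    rw [disjointMasks, Bool.and_eq_true, beq_iff_eq] at h
    obtain ⟨hor, hl⟩ := List.pairwise_cons.1 (ih h.2)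
    have hsplit : ∀ n ∈ l, u &&& n = 0 ∧ m &&& n = 0 := fun n hn => by
      rw [← Nat.or_eq_zero_iff, ← Nat.and_or_distrib_right]
      exact hor n hn
    refine List.pairwise_cons.2 ⟨fun n hn => ?_, List.pairwise_cons.2
      ⟨fun n hn => (hsplit n hn).2, hl⟩⟩
    rcases List.mem_cons.1 hn with rfl | hn
    · exact h.1
    · exact (hsplit n hn).1

/-- The line masks of two triples have no binary digit in common. -/
def HaveNoCommonLine (s t : ℕ × ℕ × ℕ) : Prop := lineMask s &&& lineMask t = 0

instance : Std.Symm HaveNoCommonLine where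
  symm s t h := by
    unfold HaveNoCommonLine at h ⊢
    rwa [Nat.land_comm]

lemma HaveNoCommonLine.eq_of_mem {s t : ℕ × ℕ × ℕ} {m n : ℕ} (h : HaveNoCommonLine s t)
    (hms : m ∈ nonzeroSums s) (hns : n ∈ nonzeroSums s) (hmt : m ∈ nonzeroSums t)
    (hnt : n ∈ nonzeroSums t) : m = n := by
  by_contra hmn
  have hbit := congrArg (fun k => k.testBit (2 ^ 7 * m + n)) h
  simp only [Nat.testBit_and, testBit_lineMask hms hns hmn, testBit_lineMask hmt hnt hmn,
    Nat.zero_testBit, Bool.and_self, Bool.true_eq_false] at hbit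

lemma IsBinaryBasis.not_haveNoCommonLine_self {t : ℕ × ℕ × ℕ} (ht : IsBinaryBasis t) :
    ¬ HaveNoCommonLine t t := by
  intro h
  have heq : t.1 = t.2.1 := h.eq_of_mem (by simp [nonzeroSums]) (by simp [nonzeroSums])
    (by simp [nonzeroSums]) (by simp [nonzeroSums])
  have hnodup := ht.1
  simp [nonzeroSums, heq] at hnodup

lemma exists_mem_nonzeroSums {t : ℕ × ℕ × ℕ} {v : V} (hv : v ∈ binarySpan t) (h0 : v ≠ 0) :
    ∃ n ∈ nonzeroSums t, binaryVec n = v := by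
  obtain ⟨n, hn, rfl⟩ := mem_binarySpan.1 hv
  rcases List.mem_cons.1 hn with rfl | hn
  · exact absurd binaryVec_zero h0
  · exact ⟨n, hn, rfl⟩

lemma HaveNoCommonLine.finrank_inf_le_one {s t : ℕ × ℕ × ℕ} (hs : IsBinaryBasis s)
    (ht : IsBinaryBasis t) (h : HaveNoCommonLine s t) :
    Module.finrank (ZMod 2) ↥(binarySpan s ⊓ binarySpan t) ≤ 1 := by
  have hcommon : ∀ v ∈ binarySpan s ⊓ binarySpan t, v ≠ 0 →
      ∃ n, n ∈ nonzeroSums s ∧ n ∈ nonzeroSums t ∧ binaryVec n = v := by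
    intro v hv h0
    obtain ⟨m, hm, hmv⟩ := exists_mem_nonzeroSums hv.1 h0
    obtain ⟨n, hn, hnv⟩ := exists_mem_nonzeroSums hv.2 h0
    obtain rfl : m = n := injOn_binaryVec (hs.2 m (List.mem_cons_of_mem 0 hm))
      (ht.2 n (List.mem_cons_of_mem 0 hn)) (hmv.trans hnv.symm)
    exact ⟨m, hm, hn, hmv⟩
  by_cases hbot : binarySpan s ⊓ binarySpan t = ⊥
  · rw [hbot, finrank_bot]
    exact zero_le_one
  · obtain ⟨v, hv, hv0⟩ := Submodule.exists_mem_ne_zero_of_ne_bot hbot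
    obtain ⟨m, hms, hmt, hmv⟩ := hcommon v hv hv0
    refine finrank_le_one (⟨v, hv⟩ : ↥(binarySpan s ⊓ binarySpan t)) fun w => ?_
    by_cases hw0 : (w : V) = 0
    · exact ⟨0, by ext1; simp [hw0]⟩
    · obtain ⟨n, hns, hnt, hnw⟩ := hcommon w w.2 hw0
      refine ⟨1, (one_smul _ _).trans (Subtype.ext ?_)⟩
      exact hmv.symm.trans ((congrArg binaryVec (h.eq_of_mem hms hns hmt hnt)).trans hnw)

/-- Bases of the `333` codewords. -/
def codewordBases : List (ℕ × ℕ × ℕ) :=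
  [(1, 2, 92), (1, 4, 18), (1, 6, 40), (1, 8, 70), (1, 10, 66), (1, 12, 54), (1, 14, 102),
    (1, 16, 34), (1, 20, 98), (1, 24, 96), (1, 26, 42), (1, 28, 108), (1, 30, 68), (1, 32, 84),
    (1, 36, 74), (1, 38, 88), (1, 44, 86), (1, 52, 80), (1, 56, 82), (1, 60, 64), (1, 62, 76),
    (2, 4, 80), (2, 5, 32), (2, 8, 100), (2, 9, 112), (2, 12, 33), (2, 13, 21), (2, 16, 109),
    (2, 17, 73), (2, 20, 36), (2, 25, 76), (2, 28, 40), (2, 29, 104), (2, 41, 64), (2, 44, 77),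
    (2, 49, 81), (2, 53, 65), (2, 56, 68), (2, 57, 72), (2, 60, 89), (2, 61, 69), (3, 4, 25),
    (3, 5, 96), (3, 8, 116), (3, 9, 80), (3, 12, 113), (3, 13, 68), (3, 16, 105), (3, 17, 36),
    (3, 20, 64), (3, 21, 45), (3, 24, 33), (3, 28, 44), (3, 32, 65), (3, 37, 77), (3, 40, 88),
    (3, 41, 69), (3, 49, 85), (3, 52, 76), (3, 60, 81), (3, 61, 72), (4, 9, 98), (4, 10, 49),
    (4, 11, 33), (4, 17, 105), (4, 24, 75), (4, 32, 64), (4, 35, 90), (4, 40, 89), (4, 41, 67),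
    (4, 43, 81), (4, 48, 66), (4, 50, 65), (4, 51, 91), (4, 56, 72), (4, 57, 88), (5, 8, 49),
    (5, 9, 64), (5, 11, 80), (5, 17, 43), (5, 24, 107), (5, 25, 33), (5, 26, 97), (5, 27, 66),
    (5, 40, 90), (5, 41, 65), (5, 42, 83), (5, 48, 74), (5, 50, 88), (5, 51, 67), (5, 59, 82),
    (6, 8, 18), (6, 9, 51), (6, 10, 50), (6, 11, 115), (6, 17, 106), (6, 19, 74), (6, 24, 64),
    (6, 27, 105), (6, 32, 81), (6, 33, 91), (6, 34, 67), (6, 35, 83), (6, 43, 73), (6, 49, 90),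
    (6, 59, 66), (7, 8, 80), (7, 9, 113), (7, 10, 33), (7, 11, 97), (7, 17, 99), (7, 18, 65),
    (7, 19, 72), (7, 24, 35), (7, 27, 96), (7, 48, 89), (7, 50, 75), (7, 51, 64), (7, 56, 90),
    (7, 57, 67), (7, 58, 82), (8, 17, 103), (8, 21, 67), (8, 22, 35), (8, 23, 32), (8, 33, 81),
    (8, 34, 66), (8, 37, 64), (8, 38, 85), (8, 39, 68), (8, 48, 65), (8, 50, 83), (8, 54, 84),
    (9, 17, 37), (9, 18, 32), (9, 20, 35), (9, 22, 67), (9, 23, 96), (9, 33, 66), (9, 34, 86),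
    (9, 36, 81), (9, 38, 65), (9, 48, 84), (9, 54, 87), (10, 17, 64), (10, 18, 68), (10, 20, 103),
    (10, 21, 101), (10, 22, 97), (10, 23, 39), (10, 32, 82), (10, 35, 87), (10, 36, 70),
    (10, 37, 84), (10, 51, 69), (10, 54, 85), (11, 17, 69), (11, 18, 38), (11, 21, 39),
    (11, 22, 71), (11, 23, 34), (11, 35, 68), (11, 36, 82), (11, 48, 83), (11, 49, 64),
    (11, 51, 87), (11, 54, 86), (12, 16, 100), (12, 17, 68), (12, 18, 67), (12, 21, 37),
    (12, 23, 98), (12, 32, 83), (12, 34, 82), (12, 36, 65), (12, 38, 80), (12, 39, 71),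
    (12, 49, 70), (12, 51, 84), (12, 53, 86), (13, 16, 64), (13, 18, 99), (13, 19, 101),
    (13, 20, 70), (13, 22, 69), (13, 35, 84), (13, 36, 86), (13, 37, 81), (13, 39, 67),
    (13, 48, 87), (13, 50, 66), (13, 53, 85), (14, 17, 66), (14, 19, 37), (14, 21, 38),
    (14, 22, 98), (14, 23, 65), (14, 32, 69), (14, 34, 70), (14, 36, 84), (14, 39, 82),
    (14, 48, 81), (14, 52, 87), (14, 55, 64), (15, 16, 38), (15, 17, 32), (15, 19, 65),
    (15, 20, 100), (15, 22, 101), (15, 34, 84), (15, 35, 67), (15, 36, 83), (15, 39, 69),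
    (15, 48, 68), (15, 50, 81), (15, 52, 85), (15, 55, 66), (16, 32, 76), (16, 33, 79),
    (16, 37, 66), (16, 40, 78), (16, 42, 65), (17, 33, 67), (17, 38, 71), (17, 40, 70),
    (17, 42, 79), (17, 45, 77), (18, 33, 72), (18, 34, 71), (18, 35, 73), (18, 37, 69),
    (18, 42, 75), (18, 43, 76), (18, 44, 74), (18, 46, 66), (18, 47, 77), (19, 38, 64),
    (19, 40, 67), (19, 41, 77), (20, 32, 74), (20, 34, 76), (20, 37, 68), (20, 39, 66),
    (20, 40, 71), (20, 44, 69), (20, 45, 65), (20, 47, 73), (21, 33, 73), (21, 34, 68),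
    (21, 35, 71), (21, 36, 72), (21, 42, 64), (21, 43, 69), (21, 47, 79), (22, 32, 79),
    (22, 33, 70), (22, 34, 75), (22, 39, 65), (22, 40, 64), (22, 41, 73), (22, 44, 66),
    (23, 33, 68), (23, 35, 72), (23, 36, 73), (23, 38, 69), (23, 42, 76), (23, 43, 74),
    (23, 44, 75), (23, 47, 71), (24, 32, 67), (24, 38, 66), (24, 39, 72), (24, 41, 76),
    (24, 42, 71), (24, 43, 65), (24, 45, 69), (24, 46, 73), (25, 32, 73), (25, 34, 64),
    (25, 35, 69), (25, 42, 68), (25, 43, 67), (25, 44, 71), (25, 46, 74), (25, 47, 66),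
    (26, 32, 71), (26, 33, 76), (26, 35, 75), (26, 36, 79), (26, 37, 67), (26, 38, 68),
    (26, 39, 73), (26, 40, 72), (26, 41, 74), (26, 44, 64), (26, 46, 65), (26, 47, 70),
    (27, 37, 70), (27, 39, 79), (27, 44, 73), (27, 45, 75), (27, 46, 68), (27, 47, 67),
    (28, 32, 70), (28, 35, 74), (28, 37, 71), (28, 38, 67), (28, 39, 77), (28, 43, 72),
    (28, 45, 66), (28, 46, 64), (29, 33, 69), (29, 34, 65), (29, 36, 66), (29, 38, 70),
    (29, 40, 73), (29, 41, 78), (29, 47, 74), (30, 34, 73), (30, 36, 78), (30, 37, 65),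
    (30, 38, 74), (30, 41, 75), (30, 45, 76), (30, 46, 72), (31, 33, 65), (31, 34, 79),
    (31, 37, 73), (31, 39, 64), (31, 42, 72), (31, 43, 77), (31, 45, 70), (31, 46, 71)]

lemma isBinaryBasis_codewordBases : ∀ t ∈ codewordBases, IsBinaryBasis t := by
  decide +kernel

lemma disjointMasks_codewordBases : disjointMasks 0 (codewordBases.map lineMask) = true := by
  decide +kernel

lemma pairwise_codewordBases : codewordBases.Pairwise HaveNoCommonLine := by
  have h := (pairwise_of_disjointMasks disjointMasks_codewordBases).of_cons
  rwa [List.pairwise_map] at h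

lemma nodup_codewordBases : codewordBases.Nodup := by
  refine pairwise_codewordBases.imp_of_mem ?_
  rintro s _ hs - h rfl
  exact (isBinaryBasis_codewordBases s hs).not_haveNoCommonLine_self h

lemma finrank_inf_le_one_of_ne {s t : ℕ × ℕ × ℕ} (hs : s ∈ codewordBases)
    (ht : t ∈ codewordBases) (hst : s ≠ t) :
    Module.finrank (ZMod 2) ↥(binarySpan s ⊓ binarySpan t) ≤ 1 :=
  (pairwise_codewordBases.forall hs ht hst).finrank_inf_le_one
    (isBinaryBasis_codewordBases s hs) (isBinaryBasis_codewordBases t ht)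

lemma isCode_codewordBases : IsCode (binarySpan '' {t | t ∈ codewordBases}) := by
  constructor
  · rintro _ ⟨t, ht, rfl⟩
    exact (isBinaryBasis_codewordBases t ht).finrank_binarySpan
  · rintro _ ⟨s, hs, rfl⟩ _ ⟨t, ht, rfl⟩ hne
    exact finrank_inf_le_one_of_ne hs ht fun h => hne (congrArg binarySpan h)

lemma injOn_binarySpan_codewordBases : Set.InjOn binarySpan {t | t ∈ codewordBases} := by
  intro s hs t ht h
  by_contra hst
  have hle := finrank_inf_le_one_of_ne hs ht hst
  rw [← h, inf_idem, (isBinaryBasis_codewordBases s hs).finrank_binarySpan] at hle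
  omega

lemma length_codewordBases : codewordBases.length = 333 := by
  decide +kernel

lemma ncard_codewordBases : (binarySpan '' {t | t ∈ codewordBases}).ncard = 333 := by
  rw [injOn_binarySpan_codewordBases.ncard_image, ← List.coe_toFinset,
    Set.ncard_coe_finset, List.toFinset_card_of_nodup nodup_codewordBases,
    length_codewordBases]

/-- There exists a set `C` of 333 three-dimensional subspaces of `F₂⁷` mutually intersecting
in dimension at most 1; in particular `A₂(7,4;3) ≥ 333`. -/
theorem stmt_0 :
    (∃ C : Set (Submodule (ZMod 2) V), IsCode C ∧ C.ncard = 333) ∧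
    333 ≤ sSup {m : ℕ | ∃ C : Set (Submodule (ZMod 2) V), IsCode C ∧ C.ncard = m} := by
  have hcode : ∃ C : Set (Submodule (ZMod 2) V), IsCode C ∧ C.ncard = 333 :=
    ⟨_, isCode_codewordBases, ncard_codewordBases⟩
  refine ⟨hcode, le_csSup ⟨Nat.card (Submodule (ZMod 2) V), ?_⟩ hcode⟩
  rintro m ⟨C, -, rfl⟩
  have : Finite (Submodule (ZMod 2) V) := Finite.of_injective _ SetLike.coe_injective
  exact Set.ncard_le_card C
end

section
/- There exists a set C of 333 three-dimensional F₂-linear subspaces of F₂⁷, any two distinct members of which intersect in a subspace of dimension at most 1, whose automorphism group Aut(C) has order 4 and is isomorphic to the Klein four-group Z₂ × Z₂. -/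
/-! ### Binary encoding of vectors -/

/-- The vector of `F₂⁷` whose coordinates are the binary digits of `n`. -/
def toVec (n : ℕ) : V := fun i => if n.testBit i then 1 else 0

lemma toVec_xor (a b : ℕ) : toVec (a ^^^ b) = toVec a + toVec b := by
  ext i
  simp only [toVec, Nat.testBit_xor, Pi.add_apply]
  cases a.testBit i <;> cases b.testBit i <;> decide

lemma toVec_zero : toVec 0 = 0 := by
  ext i
  simp [toVec]

lemma toVec_injOn {a b : ℕ} (ha : a < 128) (hb : b < 128) (h : toVec a = toVec b) : a = b := by
  refine Nat.eq_of_testBit_eq fun i => ?_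
  by_cases hi : i < 7
  · have := congrFun h ⟨i, hi⟩
    simp only [toVec] at this
    revert this
    cases a.testBit i <;> cases b.testBit i <;> simp
  · have h7 : 128 ≤ 2 ^ i := Nat.pow_le_pow_right (i := 7) two_pos (by omega)
    rw [Nat.testBit_lt_two_pow (by omega), Nat.testBit_lt_two_pow (by omega)]

/-- Binary encoding as a bijection. -/
noncomputable def vecEquiv : Fin 128 ≃ V :=
  Equiv.ofBijective (fun n => toVec n) <| by
    rw [Fintype.bijective_iff_injective_and_card]
    exact ⟨fun a b h => Fin.ext (toVec_injOn a.2 b.2 h), by simp⟩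

lemma exists_toVec (v : V) : ∃ n < 128, toVec n = v :=
  ⟨vecEquiv.symm v, (vecEquiv.symm v).2, vecEquiv.apply_symm_apply v⟩

/-! ### Planes spanned by encoded triples -/

/-- The span of the three vectors encoded by `t`. -/
def plane (t : ℕ × ℕ × ℕ) : Submodule (ZMod 2) V :=
  Submodule.span (ZMod 2) {toVec t.1, toVec t.2.1, toVec t.2.2}

/-- The codes of the elements of `plane t`. -/
def points (t : ℕ × ℕ × ℕ) : List ℕ :=
  [0, t.1, t.2.1, t.1 ^^^ t.2.1, t.2.2, t.1 ^^^ t.2.2, t.2.1 ^^^ t.2.2, t.1 ^^^ t.2.1 ^^^ t.2.2]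

/-- The bit mask of `points t`. -/
def mask (t : ℕ × ℕ × ℕ) : ℕ := (points t).foldr (fun n m => 2 ^ n ||| m) 0

lemma testBit_foldr_or (l : List ℕ) (n : ℕ) :
    (l.foldr (fun n m => 2 ^ n ||| m) 0).testBit n = true ↔ n ∈ l := by
  induction l with
  | nil => simp
  | cons a l ih =>
    rw [List.foldr_cons, Nat.testBit_or, Bool.or_eq_true, ih, Nat.testBit_two_pow, List.mem_cons]
    simp [eq_comm]

lemma testBit_mask (t : ℕ × ℕ × ℕ) (n : ℕ) : (mask t).testBit n = true ↔ n ∈ points t :=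
  testBit_foldr_or _ _

lemma mem_plane (t : ℕ × ℕ × ℕ) (v : V) : v ∈ plane t ↔ ∃ n ∈ points t, toVec n = v := by
  obtain ⟨a, b, c⟩ := t
  have h2 : ∀ x : ZMod 2, x = 0 ∨ x = 1 := by decide
  simp only [plane, points, Submodule.mem_span_triple, List.mem_cons, List.not_mem_nil, or_false,
    exists_eq_or_imp, exists_eq_left, toVec_xor, toVec_zero]
  constructor
  · rintro ⟨x, y, z, rfl⟩
    rcases h2 x with rfl | rfl <;> rcases h2 y with rfl | rfl <;> rcases h2 z with rfl | rfl <;>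
      simp
  · rintro (h | h | h | h | h | h | h | h)
    · exact ⟨0, 0, 0, by simpa using h⟩
    · exact ⟨1, 0, 0, by simpa using h⟩
    · exact ⟨0, 1, 0, by simpa using h⟩
    · exact ⟨1, 1, 0, by simpa using h⟩
    · exact ⟨0, 0, 1, by simpa using h⟩
    · exact ⟨1, 0, 1, by simpa using h⟩
    · exact ⟨0, 1, 1, by simpa using h⟩
    · exact ⟨1, 1, 1, by simpa using h⟩

/-- The points of `t` are eight different codes of vectors. -/
def IsPlane (t : ℕ × ℕ × ℕ) : Prop := (∀ n ∈ points t, n < 128) ∧ (points t).Nodup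

instance (t : ℕ × ℕ × ℕ) : Decidable (IsPlane t) := inferInstanceAs (Decidable (_ ∧ _))

lemma IsPlane.toVec_mem {t : ℕ × ℕ × ℕ} (ht : IsPlane t) {n : ℕ} (hn : n < 128) :
    toVec n ∈ plane t ↔ (mask t).testBit n = true := by
  rw [mem_plane, testBit_mask]
  constructor
  · rintro ⟨m, hm, h⟩
    rwa [← toVec_injOn (ht.1 m hm) hn h]
  · exact fun h => ⟨n, h, rfl⟩

open Classical in
lemma IsPlane.filter_mem {t : ℕ × ℕ × ℕ} :
    ({u | u ∈ plane t} : Finset V) = ((points t).map toVec).toFinset := by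
  ext v
  simp [mem_plane]

lemma IsPlane.nodup {t : ℕ × ℕ × ℕ} (ht : IsPlane t) : ((points t).map toVec).Nodup :=
  ht.2.map_on fun a ha b hb h => toVec_injOn (ht.1 a ha) (ht.1 b hb) h

open Classical in
lemma IsPlane.sum_eq {t : ℕ × ℕ × ℕ} (ht : IsPlane t) (φ : V → ℕ) :
    ∑ u with u ∈ plane t, φ u = ((points t).map fun n => φ (toVec n)).sum := by
  rw [IsPlane.filter_mem, List.sum_toFinset _ ht.nodup, List.map_map]
  rfl

open Classical in
lemma IsPlane.finrank_eq {t : ℕ × ℕ × ℕ} (ht : IsPlane t) :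
    Module.finrank (ZMod 2) (plane t) = 3 := by
  have h8 : Fintype.card (plane t) = 2 ^ 3 := by
    rw [Fintype.card_subtype, IsPlane.filter_mem, List.toFinset_card_of_nodup ht.nodup]
    simp [points]
  rw [Module.card_eq_pow_finrank (K := ZMod 2), ZMod.card] at h8
  exact Nat.pow_right_injective le_rfl h8

lemma plane_eq_of_mask_eq {t t' : ℕ × ℕ × ℕ} (h : mask t = mask t') : plane t = plane t' := by
  ext v
  simp only [mem_plane, ← testBit_mask, h]

/-- The masks `m` and `m'` have at most one common bit in a nonzero position. -/
def AlmostDisjoint (m m' : ℕ) : Prop :=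
  ((m &&& m') >>> 1) &&& ((m &&& m') >>> 1 - 1) = 0

instance (m m' : ℕ) : Decidable (AlmostDisjoint m m') := inferInstanceAs (Decidable (_ = _))

lemma eq_of_and_sub_one_eq_zero {x i j : ℕ} (hx : x &&& (x - 1) = 0) (hi : x.testBit i = true)
    (hj : x.testBit j = true) : i = j := by
  have h0 : x ≠ 0 := by
    rintro rfl
    simp at hi
  obtain ⟨k, rfl⟩ := (Nat.and_sub_one_eq_zero_iff_isPowerOfTwo h0).1 hx
  rw [Nat.testBit_two_pow] at hi hj
  simp_all

lemma AlmostDisjoint.eq {m m' a b : ℕ} (h : AlmostDisjoint m m') (ha : a ≠ 0) (hb : b ≠ 0)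
    (ham : m.testBit a = true) (ham' : m'.testBit a = true) (hbm : m.testBit b = true)
    (hbm' : m'.testBit b = true) : a = b := by
  have key : a - 1 = b - 1 := by
    refine eq_of_and_sub_one_eq_zero h ?_ ?_
    · rw [Nat.testBit_shiftRight, Nat.testBit_and, show 1 + (a - 1) = a by omega, ham, ham']; rfl
    · rw [Nat.testBit_shiftRight, Nat.testBit_and, show 1 + (b - 1) = b by omega, hbm, hbm']; rfl
  omega

lemma AlmostDisjoint.finrank_le {t t' : ℕ × ℕ × ℕ} (ht : IsPlane t) (ht' : IsPlane t')
    (h : AlmostDisjoint (mask t) (mask t')) :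
    Module.finrank (ZMod 2) ↥(plane t ⊓ plane t') ≤ 1 := by
  have huniq : ∀ v ∈ plane t ⊓ plane t', ∀ w ∈ plane t ⊓ plane t', v ≠ 0 → w ≠ 0 → v = w := by
    intro v hv w hw hv0 hw0
    obtain ⟨a, ha, rfl⟩ := exists_toVec v
    obtain ⟨b, hb, rfl⟩ := exists_toVec w
    rw [Submodule.mem_inf, ht.toVec_mem ‹_›, ht'.toVec_mem ‹_›] at hv hw
    have ha0 : a ≠ 0 := by rintro rfl; exact hv0 toVec_zero
    have hb0 : b ≠ 0 := by rintro rfl; exact hw0 toVec_zero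
    rw [h.eq ha0 hb0 hv.1 hv.2 hw.1 hw.2]
  by_cases hv : ∃ v : ↥(plane t ⊓ plane t'), v ≠ 0
  · obtain ⟨v, hv⟩ := hv
    refine finrank_le_one v fun w => ?_
    by_cases hw : w = 0
    · exact ⟨0, by simp [hw]⟩
    · refine ⟨1, ?_⟩
      rw [one_smul]
      exact Subtype.ext (huniq v v.2 w w.2 (by simpa using hv) (by simpa using hw))
  · push Not at hv
    exact finrank_le_one 0 fun w => ⟨0, by simp [hv w]⟩

lemma AlmostDisjoint.plane_ne {t t' : ℕ × ℕ × ℕ} (ht : IsPlane t) (ht' : IsPlane t')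
    (h : AlmostDisjoint (mask t) (mask t')) : plane t ≠ plane t' := by
  intro heq
  have := h.finrank_le ht ht'
  rw [← heq, inf_idem, ht.finrank_eq] at this
  omega

/-! ### The code -/

/-- Generating triples of the 333 codewords. -/
def code : List (ℕ × ℕ × ℕ) :=
  [(1, 2, 8), (1, 4, 72), (1, 6, 82), (1, 12, 54), (1, 14, 32), (1, 16, 98), (1, 18, 106),
   (1, 20, 44), (1, 22, 34), (1, 24, 104), (1, 26, 96), (1, 28, 74), (1, 30, 78), (1, 36, 88),
   (1, 38, 64), (1, 40, 68), (1, 42, 94), (1, 48, 70), (1, 50, 92), (1, 60, 66), (1, 62, 90),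
   (2, 4, 25), (2, 5, 17), (2, 12, 16), (2, 13, 21), (2, 32, 85), (2, 33, 77), (2, 36, 69),
   (2, 37, 93), (2, 40, 89), (2, 41, 65), (2, 44, 73), (2, 45, 81), (2, 48, 64), (2, 49, 88),
   (2, 52, 80), (2, 53, 72), (2, 56, 76), (2, 57, 84), (2, 60, 92), (2, 61, 68), (3, 4, 65),
   (3, 5, 89), (3, 12, 36), (3, 13, 49), (3, 16, 109), (3, 17, 100), (3, 20, 41), (3, 21, 37),
   (3, 24, 108), (3, 25, 101), (3, 28, 68), (3, 29, 64), (3, 32, 81), (3, 33, 72), (3, 44, 84),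
   (3, 45, 76), (3, 52, 77), (3, 53, 85), (3, 56, 80), (3, 57, 73), (4, 8, 67), (4, 9, 115),
   (4, 10, 64), (4, 11, 98), (4, 16, 43), (4, 18, 32), (4, 24, 96), (4, 26, 107), (4, 33, 81),
   (4, 34, 89), (4, 41, 91), (4, 42, 83), (4, 48, 88), (4, 51, 82), (4, 57, 90), (4, 58, 80),
   (5, 8, 48), (5, 9, 112), (5, 10, 35), (5, 11, 97), (5, 16, 75), (5, 18, 74), (5, 24, 99),
   (5, 26, 104), (5, 32, 64), (5, 33, 82), (5, 42, 65), (5, 43, 81), (5, 50, 80), (5, 51, 66),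
   (5, 58, 83), (5, 59, 67), (6, 8, 80), (6, 9, 114), (6, 10, 81), (6, 11, 99), (6, 16, 33),
   (6, 18, 40), (6, 24, 97), (6, 26, 106), (6, 32, 75), (6, 35, 65), (6, 41, 73), (6, 42, 67),
   (6, 48, 72), (6, 51, 64), (6, 56, 66), (6, 59, 74), (7, 8, 34), (7, 9, 113), (7, 10, 51),
   (7, 11, 96), (7, 16, 64), (7, 18, 67), (7, 24, 98), (7, 26, 105), (7, 32, 72), (7, 33, 88),
   (7, 40, 75), (7, 41, 89), (7, 48, 90), (7, 49, 74), (7, 58, 91), (7, 59, 73), (8, 16, 36),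
   (8, 17, 68), (8, 18, 35), (8, 19, 64), (8, 20, 102), (8, 21, 100), (8, 22, 101), (8, 23, 103),
   (8, 32, 66), (8, 33, 84), (8, 38, 82), (8, 39, 70), (8, 50, 81), (8, 51, 69), (8, 54, 65),
   (8, 55, 87), (9, 16, 70), (9, 17, 38), (9, 18, 66), (9, 19, 32), (9, 20, 65), (9, 21, 39),
   (9, 22, 69), (9, 23, 33), (9, 34, 71), (9, 35, 64), (9, 36, 67), (9, 37, 68), (9, 48, 82),
   (9, 49, 87), (9, 52, 84), (9, 53, 81), (10, 16, 34), (10, 17, 67), (10, 18, 39), (10, 19, 71),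
   (10, 20, 99), (10, 21, 96), (10, 22, 98), (10, 23, 97), (10, 32, 70), (10, 33, 80),
   (10, 36, 86), (10, 37, 66), (10, 48, 85), (10, 49, 65), (10, 54, 69), (10, 55, 83),
   (11, 16, 65), (11, 17, 33), (11, 18, 69), (11, 19, 37), (11, 20, 70), (11, 21, 36),
   (11, 22, 66), (11, 23, 32), (11, 34, 83), (11, 35, 86), (11, 38, 85), (11, 39, 80),
   (11, 50, 68), (11, 51, 67), (11, 52, 64), (11, 53, 71), (12, 17, 37), (12, 19, 38),
   (12, 21, 98), (12, 23, 101), (12, 32, 86), (12, 33, 66), (12, 34, 70), (12, 35, 80),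
   (12, 48, 65), (12, 49, 69), (12, 50, 83), (12, 51, 85), (13, 17, 69), (13, 19, 65),
   (13, 20, 97), (13, 22, 103), (13, 32, 80), (13, 33, 71), (13, 34, 86), (13, 35, 67),
   (13, 36, 70), (13, 37, 87), (13, 38, 66), (13, 39, 81), (14, 17, 34), (14, 19, 35),
   (14, 21, 102), (14, 23, 99), (14, 36, 84), (14, 37, 82), (14, 38, 70), (14, 39, 66),
   (14, 52, 65), (14, 53, 87), (14, 54, 81), (14, 55, 69), (15, 17, 66), (15, 19, 70),
   (15, 20, 100), (15, 22, 96), (15, 48, 69), (15, 49, 86), (15, 50, 65), (15, 51, 80),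
   (15, 52, 81), (15, 53, 68), (15, 54, 87), (15, 55, 64), (16, 32, 73), (16, 35, 68),
   (16, 37, 67), (16, 38, 76), (16, 41, 77), (16, 42, 66), (16, 45, 72), (16, 46, 69),
   (17, 32, 78), (17, 35, 74), (17, 36, 79), (17, 39, 75), (17, 40, 64), (17, 43, 70),
   (17, 45, 71), (17, 46, 65), (18, 33, 65), (18, 34, 76), (18, 37, 70), (18, 38, 73),
   (18, 41, 72), (18, 42, 71), (18, 44, 64), (18, 47, 77), (19, 33, 69), (19, 34, 67),
   (19, 36, 66), (19, 39, 68), (19, 40, 79), (19, 43, 75), (19, 44, 78), (19, 47, 74),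
   (20, 32, 71), (20, 33, 73), (20, 34, 64), (20, 35, 76), (20, 36, 68), (20, 37, 79),
   (20, 38, 67), (20, 39, 74), (21, 32, 65), (21, 33, 76), (21, 34, 73), (21, 35, 70),
   (21, 40, 71), (21, 41, 64), (21, 42, 77), (21, 43, 72), (22, 40, 78), (22, 41, 71),
   (22, 42, 75), (22, 43, 64), (22, 44, 72), (22, 45, 68), (22, 46, 77), (22, 47, 67),
   (23, 36, 76), (23, 37, 73), (23, 38, 68), (23, 39, 67), (23, 44, 66), (23, 45, 77),
   (23, 46, 72), (23, 47, 69), (28, 34, 77), (28, 35, 66), (28, 36, 65), (28, 37, 76),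
   (28, 40, 67), (28, 41, 78), (28, 44, 79), (28, 45, 64), (29, 33, 70), (29, 34, 79),
   (29, 36, 78), (29, 39, 69), (29, 40, 77), (29, 43, 68), (29, 44, 76), (29, 47, 71),
   (30, 34, 68), (30, 35, 75), (30, 38, 74), (30, 39, 71), (30, 42, 72), (30, 43, 69),
   (30, 44, 70), (30, 45, 73), (31, 32, 67), (31, 35, 72), (31, 36, 64), (31, 39, 73),
   (31, 40, 65), (31, 43, 74), (31, 45, 75), (31, 46, 66)]

/-- The bit masks of the codewords. -/
def codeMasks : List ℕ :=
  [3855, 240840690626351905898547, 72535549176877750482370755, 918734323983593475,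
   211119117484035, 62308513040368102714417078478241795, 3987927376269991438756508547857252355,
   216225558675062787, 13510850434301955, 15637737804415437896863330791849987,
   15950736187103478017638697504197312515, 232170425763803238091456515,
   4533471823554862626373635, 63802943798604416928846774305789313027,
   15211807202794093051006200840195, 973555660976165624068304655089667,
   249230308630793611867730213100060675, 996920996838690446453561872374300675,
   3894237499181592149338870756933635, 255211775190703847822350648972161318915,
   3806665620816379403370089152515, 2852126805, 5898405, 1342525445, 94412805,
   830767497559000551703220102103040005, 1622592769047712271174966286745605,
   792281628094122428072565145605, 6646140028442180935934246984561459205,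
   51922971680198374498761148098150405, 101412048018442819571468468224005,
   12676506049505958931624414412805, 106338239662805359090500887036035072005,
   25961484292674230377780225077411845, 202825643461565813779565903872005,
   6338259045770267598627526410245, 212676479325586563276486579989354905605,
   415383748683163999961357248144343045, 3245185633298333557577834561536005,
   420899613362793900988736471045, 13292279957849160216306811545636044805,
   1881567895518374264985, 46422751473201760308717158505, 10514079977481, 10377982391321911305,
   127607834706673874359126176723037126665, 498471907274745506403541117934370825,
   6917535624720285705, 2533687113547785, 750611414611941019049439875743875081,
   191408838998931487067524625660689514505, 2785367744723252235114381321,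
   29710561108869823262575558665, 31153781158462520688870791678263305,
   121694457664411320889536084443145, 11963051962238328174158928473355190281,
   475369655106359664343290740745, 7975367974709948584645730244268916745,
   713169519507089064340431568905, 182541697313198058865534175281161,
   46730671726841783288017249061830665, 644750598864296248086801,
   91093656086135015914939027599837372945, 321434515484388936926225,
   694989441575126769370567532382225, 9799982322740690961, 19140371435225105,
   22596877275222332581858459115298226193, 179296500896280766547693702509232145,
   88269046636195547551915975565639697, 180775007437271049048843492826827194385,
   353076228470329614443040480352534545, 45193751856851553590197104384082444305,
   344806224507245364858346197221393, 2693839732440759553561206980625,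
   10796075082610251335592551907345, 1379203873600057422193503636553745, 2387189277483082017,
   24097449720460135024010033463910470177, 20100446979105, 2678704174607277254037720960878625,
   22283260717523611562641784865, 10213628676480126061094633505,
   95704421400941643876106415075902881825, 686052504843517752090015776964083745,
   2614529363579465695161099485217, 373845373974085797443326864074473505,
   1460333491463252312062664399388705, 175458095443630655888055674446987395105,
   10458157346434976999807492554785, 93461343453629332304032861909942305,
   365083459908398591486764108480545, 43864523860902225139179353067069898785,
   20195105816662380363466686785, 53272965768567331468722892337798218305,
   12536560749403704541703050305, 1321525750737929151060313091614785, 36592305322393665,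
   1441223349015674945, 172799649751700190331858804998248857665,
   337904943996836829262961206760570945, 811296384334961476272955032862785,
   1584563252683363481624919408705, 5149831177334824859570746163265,
   2636713248475455024898081281802305, 86399819726019838692587141318647480385,
   207691874341394304190843643358085185, 26584559915698317831694766292263239745,
   674998591609622041920925677220003905, 39737037455745, 171813103048917446228074123533892993665,
   4762556605944308865, 496998263451980189724301200464001, 155953810360272672077709441,
   79789546816423294562205825, 47852210700470821938053207539838877825,
   125953763638676873332712431090139265, 2616430839480250760979933699244161,
   87729047761728013878604780127467339905, 1901476013679139832953539920001,
   669806315177003412289281130072375425, 730177887191813739994847134089345,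
   31901471898838150954903330102418866305, 5236486366179752636208660873345,
   186922686907565472544349521346297985, 1157442765156581633, 9942281793522341426493522177,
   144686968549409025, 2485556225940904526685405441, 5338984315390837421954088837602869505,
   2669166371491160056020859766481879297, 10676013913556122914171069759402017025,
   1337026582277519940181814780555690241, 81446551083626991955040406601985,
   42701449369561525387290159185511055617, 21350724683537986951081310340973068545,
   40723275835743916188743539622145, 162893723517199049367998219419905,
   85402898729180996540671578362481737985, 170805797458361699154395361549670678785,
   20401406589937237003705803342081, 39692058153088933095985447425, 4647855827829522945,
   620216798181144018758664705, 290484379351253505, 4990450542629160250789331457,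
   577657570980790785, 1247687594001833583477522945, 9241387544547951105,
   327053855163475823740054816162305, 81763463724183976110782762975745,
   1308215419454569782263919056781825, 20440866080091074473871963849217,
   162578670195052414357681735729665, 2601238993451460281248711717159425,
   40653970232947312408362875879937, 650305069819944305470839680139777, 73184610703442945,
   314330305406721914524795905, 9232414970254459905, 19826536918590611728684811265,
   43199951061654273286829278103040164865, 170307418168808923336746312983117825025,
   85153689079293426816627914120909292545, 21600117349238037176578931495199048705,
   329589156136078099740176909599745, 10644208561235545603592521183657985025,
   1349997188248186593014856849838572545, 659178312123475442378325077525505,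
   2598723383234753921417023062017025, 5322104279998236135646133544288257025,
   2699994366438715421212411667603784705, 1299342493875363678013097865380865,
   1240376817284029159382779905, 576746633983821825, 5106805483802907649992034305,
   2323927913923610625, 623958019240221202355062785, 288934133388806145,
   39633433588765944898236975105, 1188959102290626561, 5327296577175889563250553552105375745,
   85236745239688621916695007340722653185, 1370766390498920748725839022140688385,
   21932261932928200907303209815540500481, 42867602864064141659350731275963992065,
   10639016263137866680873731831745218561, 170224260210205826780350274324505036801,
   2679225179004048979989396672705726465, 76563530664513537, 153127062403026945,
   11299736355299068683646843010676690945, 85091404017789162936157424731310526465,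
   5649218983401203751581914144752799745, 2596782254869833170881141610123265,
   21550060223949957448025870700545, 170182721840290479435676824187137167361,
   42545680458834528741953029877278969857, 1412304745521483152295477058711064577,
   649235187394550284139247632912385, 86200898471174695283883526590465,
   638318145418817432864301057, 39618992555167841376287596545,
   1495706172268013812272241285958475777, 21278123797118940054234881719913160705,
   42540488171880572000653048442335010817, 167329879251376930188079002558465,
   2741532743859640318890339633475887105, 649116335781746746830555659116545,
   2596465341956430395101564656164865, 170161952649296053586397479747413090305,
   41832470412068267042071602274305, 10966130970179733960237163553061085185, 2308112420540923905,
   4612002712673337345, 42576859592997591118538099833805225985,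
   5400638403808837701239983242823614465, 85075784028350433545871401162731700225,
   3323069994418885542679506200528175105, 1298153442802124129575179072323585,
   164794578105301472899529357410305, 10799977465753045967439461802563354625,
   324836240021008922964153566511105, 50745640508238037529915797028865,
   21288417119992831646382852250764591105, 4961582753212866257553096705,
   1276636290837634865460445185, 170146539284255196000908627287062118401,
   2993359218173490642112168727377117185, 5483065482612797464713599472774447105,
   30424310746754215911293888528385, 21309186307427234858144517648952623105,
   325191994248724948440634739425281, 83684749073543926776791077781505,
   85080976323951723595477718562521513985, 1298233135186250329955000842747905,
   1993841993677978290820348369774346241, 2658496557008018513524399371074994177,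
   664624139116602870551106584087429121, 332312069558301435283434711650729985,
   5316993117729913813320185717433892865, 83078027290828900440500852909735937,
   1329248278199355301927900593266950145, 166156035083804675065485007897296897,
   10633986225594842417729082939720925185, 170142481574298248927182071748280582145,
   1329268563080022144282472917428731905, 5317074262224137796463518800079355905,
   42535620384908944177883867265317863425, 2658476273981853267708127687458553857,
   21268296969820714505705011700545224705, 10633905095995115204703686662230769665,
   85073187878665092251594462288299556865, 20769266671973268231116568081465345,
   21268946026580403859798137393434066945, 10385227561713763113245459674824705,
   42537892016022464870044321340729851905, 41538534562548411785245253592940545,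
   170141832497615236572623841588423163905, 85070916248793110018907341214984699905,
   5192653385417259851485242626146305, 664615265620430007433577561227526145,
   20769345891673412436927358389714945, 166158570077933322492816288274448385,
   5192930838577741806313107779747841, 83086895893723688519490180892590081,
   41538454405963924117855980195676161, 10384920533542267275746852362256385,
   332309534866418334946438616602640385, 41548516082754214608118016403046401,
   21267668224871787377156352058065944577, 332307315878221856861894695441137665,
   10636420115018154964765821544835317761, 83076828965928977288626887036239873,
   85070672862349515014006478598726221825, 10387129173012764201615284889452545,
   2659105048484208117295448659139231745, 83076908212225120601492546121629697,
   1329877033511278303868293032313880577, 85070753994463214681117559089040195585,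
   5194832169407871253885673415901185, 5319508131573768972197037549534838785,
   21267688497416546915629096769920434177, 20779328948577271121507291217526785,
   332307642675054123601872396782403585, 5197367770722986434072327103709185,
   1330526070001969801856784613416894465, 664614166252341059348409776240328705,
   42535458124471508419493149653182971905, 20770474891784889964338718393237505,
   170141224025293275034031011243118034945, 166154135774445792598016972118032385,
   5317236501732007692287888045977370625, 170141203745354791019794465995798609921,
   10634148504640035483257415813293932545, 166153816395436242875711694301036545,
   41539642538221809945714148549591041, 2659754065823151153305869517569654785,
   664614078358711606017338787762274305, 10389703933556547817504202716872705,
   42535376994760558833249988924915318785, 44134523300115006820876341670313985,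
   42535296043380673673026933880766070785, 2658458536774552553515005123605037057,
   166194064293606271281279646318985217, 664776296783368554525921194006282241,
   10633834107489266743808040028407332865, 170141184094304807715269027879651901441,
   11033635776146684299490612599586817, 5316922126820346577765742995690225665,
   5841333971291856493734694228066305, 664695127540846181289535267168845825,
   170141183777691367389150040443934736385, 1329230531087476370918684810811539457,
   23365336482377039137005745423253505, 42535295944347963856689699237864144897,
   166173783120660536253288177440129025, 1329233067625257121407620024205574145,
   332327281394556027361749847720853505, 21093706007159439892728556703186945,
   85070591810081750761078036762663583745, 21267648249548679998344590474235346945,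
   6490373549049203411250025336930305, 83157879684458039152293009575378945,
   5316913250945015669490554996736917505, 21267648571335714394514459445407252481,
   83239009168133683849956464399482881, 10633825273544008487615231672597872641,
   11682668009084059424553769153593345, 332347583572476937062402104055824385,
   85070591888729645410070439055069282305, 2658461062191613250772078217756934145,
   41862903325457435825678941530619905]

lemma map_mask_code : code.map mask = codeMasks := by
  decide +kernel

lemma isPlane_of_mem_code : ∀ t ∈ code, IsPlane t := by
  decide +kernel

lemma pairwise_codeMasks : codeMasks.Pairwise AlmostDisjoint := by
  decide +kernel

/-- The code as a list of subspaces. -/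
def codePlanes : List (Submodule (ZMod 2) V) := code.map plane

lemma pairwise_code : code.Pairwise fun t t' => AlmostDisjoint (mask t) (mask t') := by
  rw [← List.pairwise_map (f := mask) (R := AlmostDisjoint), map_mask_code]
  exact pairwise_codeMasks

lemma nodup_codePlanes : codePlanes.Nodup := by
  rw [codePlanes, List.Nodup, List.pairwise_map]
  refine pairwise_code.imp_of_mem fun {t t'} ht ht' h => ?_
  exact h.plane_ne (isPlane_of_mem_code t ht) (isPlane_of_mem_code t' ht')

open Classical in
/-- The code as a finite set of subspaces. -/
noncomputable def codeSet : Finset (Submodule (ZMod 2) V) := codePlanes.toFinset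

lemma mem_codeSet {W : Submodule (ZMod 2) V} : W ∈ codeSet ↔ ∃ t ∈ code, plane t = W := by
  simp [codeSet, codePlanes]

lemma card_codeSet : codeSet.card = 333 := by
  classical
  rw [codeSet, List.toFinset_card_of_nodup nodup_codePlanes, codePlanes, List.length_map]
  decide +kernel

lemma isCode_codeSet : IsCode codeSet := by
  constructor
  · intro W hW
    obtain ⟨t, ht, rfl⟩ := mem_codeSet.1 hW
    exact (isPlane_of_mem_code t ht).finrank_eq
  · intro W₁ h₁ W₂ h₂ hne
    have hsymm : Std.Symm fun W W' : Submodule (ZMod 2) V =>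
        Module.finrank (ZMod 2) ↥(W ⊓ W') ≤ 1 :=
      ⟨fun W W' h => by rwa [inf_comm]⟩
    have h : codePlanes.Pairwise fun W W' : Submodule (ZMod 2) V =>
        Module.finrank (ZMod 2) ↥(W ⊓ W') ≤ 1 :=
      List.pairwise_map.2 <| pairwise_code.imp_of_mem fun {t t'} ht ht' h =>
        h.finrank_le (isPlane_of_mem_code t ht) (isPlane_of_mem_code t' ht')
    refine h.forall ?_ ?_ hne
    · simpa [codeSet] using h₁
    · simpa [codeSet] using h₂

/-! ### An invariant colouring of the vectors -/

open Classical in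
/-- One refinement step of a colouring of the vectors with respect to the code. -/
noncomputable def recolor (φ : V → ℕ) (v : V) : ℕ :=
  (∑ W ∈ codeSet, if v ∈ W then (∑ u with u ∈ W, φ u) ^ 2 else 0) % 22

/-- The action of an invertible matrix on vectors. -/
def mulVecEquiv (M : GL (Fin 7) (ZMod 2)) : V ≃ V where
  toFun v := M.1.mulVec v
  invFun v := M⁻¹.1.mulVec v
  left_inv v := by simp [Matrix.mulVec_mulVec]
  right_inv v := by simp [Matrix.mulVec_mulVec]

lemma smul_eq_map (M : GL (Fin 7) (ZMod 2)) (W : Submodule (ZMod 2) V) :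
    M • W = W.map (Matrix.mulVecLin M.1) := rfl

lemma mulVec_mem_smul (M : GL (Fin 7) (ZMod 2)) (W : Submodule (ZMod 2) V) (v : V) :
    M.1.mulVec v ∈ M • W ↔ v ∈ W := by
  rw [smul_eq_map, Submodule.mem_map]
  constructor
  · rintro ⟨w, hw, h⟩
    rwa [← (mulVecEquiv M).injective h]
  · exact fun h => ⟨v, h, rfl⟩

lemma mem_aut_iff {M : GL (Fin 7) (ZMod 2)} {C : Set (Submodule (ZMod 2) V)} :
    M ∈ Aut C ↔ (fun W : Submodule (ZMod 2) V => M • W) '' C = C := Iff.rfl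

lemma smul_mem_iff {M : GL (Fin 7) (ZMod 2)} {C : Set (Submodule (ZMod 2) V)} (hM : M ∈ Aut C)
    (W : Submodule (ZMod 2) V) : M • W ∈ C ↔ W ∈ C := by
  conv_lhs => rw [← mem_aut_iff.1 hM]
  exact (MulAction.injective M).mem_set_image

lemma smul_mem_codeSet {M : GL (Fin 7) (ZMod 2)} (hM : M ∈ Aut codeSet)
    (W : Submodule (ZMod 2) V) : M • W ∈ codeSet ↔ W ∈ codeSet := by
  simpa using smul_mem_iff hM W

open Classical in
lemma sum_mem_smul {M : GL (Fin 7) (ZMod 2)} {φ : V → ℕ} (hφ : ∀ v, φ (M.1.mulVec v) = φ v)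
    (W : Submodule (ZMod 2) V) : ∑ u with u ∈ M • W, φ u = ∑ u with u ∈ W, φ u :=
  (Finset.sum_equiv (mulVecEquiv M) (fun u => by simp [mulVecEquiv, mulVec_mem_smul])
    fun u _ => (hφ u).symm).symm

lemma recolor_mulVec {M : GL (Fin 7) (ZMod 2)} (hM : M ∈ Aut codeSet) {φ : V → ℕ}
    (hφ : ∀ v, φ (M.1.mulVec v) = φ v) (v : V) : recolor φ (M.1.mulVec v) = recolor φ v := by
  classical
  rw [recolor, recolor]
  refine congrArg (· % 22) (Finset.sum_equiv (MulAction.toPerm M)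
    (fun W => (smul_mem_codeSet hM W).symm) fun W _ => ?_).symm
  rw [MulAction.toPerm_apply, sum_mem_smul hφ]
  exact if_congr (mulVec_mem_smul M W v).symm rfl rfl

/-- The `n`-th base 32 digit of `T`. -/
def digit (T n : ℕ) : ℕ := (T >>> (5 * n)) % 32

/-- The colouring `recolor` on codes of vectors. -/
def recolorNat (φ : ℕ → ℕ) (n : ℕ) : ℕ :=
  ((code.zip codeMasks).map fun p =>
    if p.2.testBit n then ((points p.1).map φ).sum ^ 2 else 0).sum % 22

lemma recolor_toVec (φ : V → ℕ) {n : ℕ} (hn : n < 128) :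
    recolor φ (toVec n) = recolorNat (fun k => φ (toVec k)) n := by
  classical
  rw [recolor, recolorNat, codeSet, List.sum_toFinset _ nodup_codePlanes, codePlanes,
    ← map_mask_code, List.zip_map_right, List.map_map, List.map_map]
  rw [show code.zip code = code.map fun t => (t, t) by
    simp [List.zip_eq_zipWith], List.map_map]
  congr 2
  refine List.map_congr_left fun t ht => ?_
  simp only [Function.comp_apply, Prod.map, id, (isPlane_of_mem_code t ht).toVec_mem hn,
    (isPlane_of_mem_code t ht).sum_eq]

/-- Base 32 digits of the colours after one refinement step. -/
def colors₁ : ℕ :=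
  883053022765586171349904181748443482237399065919277518728251196511561748313279053278934647231921236805599102301961844752960379340919136780504611256052945211563705286310136759927377419934173264

/-- Base 32 digits of the colours after two refinement steps. -/
def colors₂ : ℕ :=
  36757945524590611260711614579960108550260191728537624717275079501323969718366209635780165943014900003600618231511825563551266569381934240533893702106192362173993891669593091918265989640224770

/-- Base 32 digits of the colours after three refinement steps. -/
def colors₃ : ℕ :=
  662217906226238670088026016992215871925453094066753719730230826024762000308026874252187117484051816974126432671886502312478258814471565234402285615347303315912755486390053069702898812515778576

lemma recolorNat_one : ∀ n < 128, recolorNat (fun _ => 1) n = digit colors₁ n := by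
  decide +kernel

lemma recolorNat_colors₁ : ∀ n < 128, recolorNat (digit colors₁) n = digit colors₂ n := by
  decide +kernel

lemma recolorNat_colors₂ : ∀ n < 128, recolorNat (digit colors₂) n = digit colors₃ n := by
  decide +kernel

lemma recolorNat_congr {φ ψ : ℕ → ℕ} (h : ∀ n < 128, φ n = ψ n) (n : ℕ) :
    recolorNat φ n = recolorNat ψ n := by
  unfold recolorNat
  congr 2
  refine List.map_congr_left fun p hp => ?_
  have hmem : p.1 ∈ code := (List.of_mem_zip hp).1
  rw [List.map_congr_left fun k hk => h k ((isPlane_of_mem_code _ hmem).1 k hk)]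

/-- The colouring after three refinement steps. -/
noncomputable def color : V → ℕ := recolor (recolor (recolor fun _ => 1))

lemma color_mulVec {M : GL (Fin 7) (ZMod 2)} (hM : M ∈ Aut codeSet) (v : V) :
    color (M.1.mulVec v) = color v :=
  recolor_mulVec hM (recolor_mulVec hM (recolor_mulVec hM fun _ => rfl)) v

lemma color_toVec {n : ℕ} (hn : n < 128) : color (toVec n) = digit colors₃ n := by
  have h₁ : ∀ n < 128, recolor (fun _ => 1) (toVec n) = digit colors₁ n := fun n hn =>
    (recolor_toVec _ hn).trans (recolorNat_one n hn)
  have h₂ : ∀ n < 128, recolor (recolor fun _ => 1) (toVec n) = digit colors₂ n := fun n hn =>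
    ((recolor_toVec _ hn).trans (recolorNat_congr h₁ n)).trans (recolorNat_colors₁ n hn)
  exact ((recolor_toVec _ hn).trans (recolorNat_congr h₂ n)).trans (recolorNat_colors₂ n hn)

/-! ### Linear maps preserving the colouring -/

/-- All ways to extend the list of images of `0, …, 2 ^ k - 1` under a colour preserving linear map
by the images of `2 ^ k, …, 2 ^ (k + 1) - 1`. -/
def extensions (imgs : List ℕ) : List (List ℕ) :=
  ((List.range 128).filter fun y => imgs.zipIdx.all fun p =>
    digit colors₃ (imgs.length ^^^ p.2) == digit colors₃ (y ^^^ p.1)).map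
    fun y => imgs ++ imgs.map (y ^^^ ·)

/-- Candidates for the lists of images of `0, …, 2 ^ k - 1`. -/
def candidates : ℕ → List (List ℕ)
  | 0 => [[0]]
  | k + 1 => (candidates k).flatMap extensions

lemma two_pow_add_eq_xor {j k : ℕ} (hj : j < 2 ^ k) : 2 ^ k + j = 2 ^ k ^^^ j := by
  have h := Nat.two_pow_add_eq_or_of_lt hj 1
  rw [mul_one] at h
  rw [h]
  refine Nat.eq_of_testBit_eq fun i => ?_
  rw [Nat.testBit_or, Nat.testBit_xor, Nat.testBit_two_pow]
  by_cases hi : k = i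
  · subst hi
    simp [Nat.testBit_lt_two_pow hj]
  · simp [hi]

lemma range_two_pow_succ_map {s : ℕ → ℕ} {k : ℕ} (hadd : ∀ a b, s (a ^^^ b) = s a ^^^ s b) :
    (List.range (2 ^ (k + 1))).map s =
      (List.range (2 ^ k)).map s ++ ((List.range (2 ^ k)).map s).map (s (2 ^ k) ^^^ ·) := by
  rw [pow_succ, mul_two, List.range_add, List.map_append, List.map_map, List.map_map]
  congr 1
  refine List.map_congr_left fun j hj => ?_
  rw [Function.comp_apply, Function.comp_apply, ← hadd, two_pow_add_eq_xor (List.mem_range.1 hj)]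

lemma map_mem_candidates {s : ℕ → ℕ} (hlt : ∀ n, s n < 128)
    (hadd : ∀ a b, s (a ^^^ b) = s a ^^^ s b)
    (hcol : ∀ n < 128, digit colors₃ (s n) = digit colors₃ n) {k : ℕ} (hk : k ≤ 7) :
    (List.range (2 ^ k)).map s ∈ candidates k := by
  induction k with
  | zero =>
    have h0 : s 0 = 0 := by simpa using hadd 0 0
    simp [candidates, h0]
  | succ k ih =>
    refine List.mem_flatMap.2 ⟨_, ih (by omega), ?_⟩
    refine List.mem_map.2 ⟨s (2 ^ k), ?_, (range_two_pow_succ_map hadd).symm⟩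
    rw [List.mem_filter]
    refine ⟨List.mem_range.2 (hlt _), ?_⟩
    rw [List.all_eq_true]
    rintro ⟨w, j⟩ hp
    obtain ⟨hj, hw⟩ := List.mem_zipIdx' hp
    rw [List.getElem_map, List.getElem_range] at hw
    rw [List.length_map, List.length_range] at hj
    have hk' : 2 ^ k < 2 ^ 7 := Nat.pow_lt_pow_right one_lt_two (by omega)
    simp only [List.length_map, List.length_range, hw, beq_iff_eq, ← hadd]
    exact (hcol _ (Nat.xor_lt_two_pow (n := 7) hk' (hj.trans hk'))).symm

/-! ### The automorphism group -/

/-- The images of the standard basis under the four automorphisms of the code. -/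
def autColumns : Fin 4 → List ℕ :=
  ![[1, 2, 4, 8, 16, 32, 64],
    [1, 2, 4, 10, 16, 54, 71],
    [1, 2, 6, 8, 16, 58, 91],
    [1, 2, 6, 10, 16, 46, 94]]

/-- The matrix whose columns are encoded by `l`. -/
def ofColumns (l : List ℕ) : Matrix (Fin 7) (Fin 7) (ZMod 2) :=
  Matrix.of fun i j => toVec (l.getD j 0) i

/-- The action of `ofColumns l` on codes of vectors. -/
def applyColumns (l : List ℕ) (n : ℕ) : ℕ :=
  (List.range 7).foldr (fun i m => if n.testBit i then l.getD i 0 ^^^ m else m) 0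

lemma ofColumns_autColumns_mul_self (i : Fin 4) :
    ofColumns (autColumns i) * ofColumns (autColumns i) = 1 := by
  revert i
  decide +kernel

/-- The four automorphisms of the code. -/
def autElement (i : Fin 4) : GL (Fin 7) (ZMod 2) :=
  ⟨ofColumns (autColumns i), ofColumns (autColumns i), ofColumns_autColumns_mul_self i,
    ofColumns_autColumns_mul_self i⟩

lemma autElement_mulVec (i : Fin 4) : ∀ n < 128,
    (autElement i).1.mulVec (toVec n) = toVec (applyColumns (autColumns i) n) := by
  revert i
  decide +kernel

lemma any_beq_mask_applyColumns (i : Fin 4) :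
    code.all (fun t => codeMasks.any (Nat.beq (mask (applyColumns (autColumns i) t.1,
      applyColumns (autColumns i) t.2.1, applyColumns (autColumns i) t.2.2)))) = true := by
  revert i
  decide +kernel

lemma mask_applyColumns_mem (i : Fin 4) (t : ℕ × ℕ × ℕ) (ht : t ∈ code) :
    mask (applyColumns (autColumns i) t.1, applyColumns (autColumns i) t.2.1,
      applyColumns (autColumns i) t.2.2) ∈ codeMasks := by
  obtain ⟨m, hm, h⟩ := List.any_eq_true.1 (List.all_eq_true.1 (any_beq_mask_applyColumns i) t ht)
  rwa [Nat.eq_of_beq_eq_true h]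

lemma autElement_injective : Function.Injective autElement := by
  intro i j h
  have : ofColumns (autColumns i) = ofColumns (autColumns j) := congrArg Units.val h
  revert i j
  decide +kernel

lemma autElement_mul_self (i : Fin 4) : autElement i * autElement i = 1 :=
  Units.ext (ofColumns_autColumns_mul_self i)

lemma lt_of_isPlane {t : ℕ × ℕ × ℕ} (ht : IsPlane t) : t.1 < 128 ∧ t.2.1 < 128 ∧ t.2.2 < 128 :=
  ⟨ht.1 _ (by simp [points]), ht.1 _ (by simp [points]), ht.1 _ (by simp [points])⟩

lemma smul_plane {M : GL (Fin 7) (ZMod 2)} {s : ℕ → ℕ}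
    (hs : ∀ n < 128, M.1.mulVec (toVec n) = toVec (s n)) {t : ℕ × ℕ × ℕ} (ht : IsPlane t) :
    M • plane t = plane (s t.1, s t.2.1, s t.2.2) := by
  obtain ⟨h₁, h₂, h₃⟩ := lt_of_isPlane ht
  simp only [smul_eq_map, plane, Submodule.map_span, Set.image_insert_eq, Set.image_singleton,
    Matrix.mulVecLin_apply, hs _ h₁, hs _ h₂, hs _ h₃]

lemma plane_mem_codeSet {t : ℕ × ℕ × ℕ} (h : mask t ∈ codeMasks) : plane t ∈ codeSet := by
  rw [← map_mask_code] at h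
  obtain ⟨t', ht', h⟩ := List.mem_map.1 h
  exact mem_codeSet.2 ⟨t', ht', plane_eq_of_mask_eq h⟩

lemma mask_mem_of_plane_mem_codeSet {t : ℕ × ℕ × ℕ} (ht : ∀ n ∈ points t, n < 128)
    (h : plane t ∈ codeSet) : mask t ∈ codeMasks := by
  obtain ⟨t', ht', h⟩ := mem_codeSet.1 h
  rw [← map_mask_code]
  refine List.mem_map.2 ⟨t', ht', Nat.eq_of_testBit_eq fun n => ?_⟩
  have hlt' := (isPlane_of_mem_code t' ht').1
  rw [Bool.eq_iff_iff, testBit_mask, testBit_mask]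
  constructor <;> intro hn
  · obtain ⟨m, hm, hmn⟩ := (mem_plane t _).1 (h ▸ (mem_plane t' _).2 ⟨n, hn, rfl⟩)
    rwa [← toVec_injOn (ht m hm) (hlt' n hn) hmn]
  · obtain ⟨m, hm, hmn⟩ := (mem_plane t' _).1 (h ▸ (mem_plane t _).2 ⟨n, hn, rfl⟩)
    rwa [← toVec_injOn (hlt' m hm) (ht n hn) hmn]

lemma autElement_mem (i : Fin 4) : autElement i ∈ Aut codeSet := by
  have hmap : ∀ W ∈ codeSet, autElement i • W ∈ codeSet := by
    intro W hW
    obtain ⟨t, ht, rfl⟩ := mem_codeSet.1 hW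
    rw [smul_plane (autElement_mulVec i) (isPlane_of_mem_code t ht)]
    exact plane_mem_codeSet (mask_applyColumns_mem i t ht)
  refine mem_aut_iff.2 (Set.Subset.antisymm ?_ fun W hW => ?_)
  · rintro _ ⟨W, hW, rfl⟩
    exact hmap W hW
  · refine ⟨autElement i • W, hmap W hW, ?_⟩
    simp only [smul_smul, autElement_mul_self, one_smul]

lemma candidates_seven : ∀ imgs ∈ candidates 7,
    mask (imgs.getD 4 0, imgs.getD 9 0, imgs.getD 115 0) ∈ codeMasks →
      ∃ i, autColumns i = (List.range 7).map fun j => imgs.getD (2 ^ j) 0 := by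
  decide +kernel

lemma mem_range_autElement {M : GL (Fin 7) (ZMod 2)} (hM : M ∈ Aut codeSet) :
    M ∈ Set.range autElement := by
  set s : ℕ → ℕ := fun n => vecEquiv.symm (M.1.mulVec (toVec n))
  have hs (n : ℕ) : M.1.mulVec (toVec n) = toVec (s n) := (vecEquiv.apply_symm_apply _).symm
  have hlt (n : ℕ) : s n < 128 := (vecEquiv.symm _).2
  have hadd (a b : ℕ) : s (a ^^^ b) = s a ^^^ s b := by
    refine toVec_injOn (hlt _) (Nat.xor_lt_two_pow (n := 7) (hlt a) (hlt b)) ?_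
    rw [toVec_xor, ← hs, ← hs, ← hs, toVec_xor, Matrix.mulVec_add]
  have hcol : ∀ n < 128, digit colors₃ (s n) = digit colors₃ n := fun n hn => by
    rw [← color_toVec hn, ← color_toVec (hlt n), ← hs, color_mulVec hM]
  have hget (n : ℕ) (hn : n < 128) : ((List.range (2 ^ 7)).map s).getD n 0 = s n := by
    simp [List.getD_eq_getElem?_getD, hn]
  have hplane : IsPlane (4, 9, 115) := by decide
  have hmem : plane (s 4, s 9, s 115) ∈ codeSet := by
    rw [← smul_plane (t := (4, 9, 115)) (fun n _ => hs n) hplane, smul_mem_codeSet hM]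
    exact plane_mem_codeSet (by decide +kernel)
  obtain ⟨i, hi⟩ := candidates_seven _ (map_mem_candidates hlt hadd hcol le_rfl) (by
    rw [hget 4 (by norm_num), hget 9 (by norm_num), hget 115 (by norm_num)]
    refine mask_mem_of_plane_mem_codeSet ?_ hmem
    simp only [points, ← hadd, List.forall_mem_cons, hlt, List.not_mem_nil]
    simp)
  refine ⟨i, Units.ext (Matrix.ext fun a b => ?_)⟩
  have hb : M.1.mulVec (toVec (2 ^ (b : ℕ))) = M.1.col b := by
    rw [← Matrix.mulVec_single_one]
    congr 1
    ext j
    simp [toVec, Nat.testBit_two_pow, Pi.single_apply, Fin.ext_iff, eq_comm]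
  have hb' : 2 ^ (b : ℕ) < 128 := Nat.pow_lt_pow_right (n := 7) one_lt_two b.2
  change toVec ((autColumns i).getD b 0) a = M.1 a b
  rw [hi, List.getD_eq_getElem _ _ (by simp), List.getElem_map, List.getElem_range, hget _ hb',
    ← hs, hb, Matrix.col_apply]

lemma coe_aut_codeSet : (Aut codeSet : Set (GL (Fin 7) (ZMod 2))) = Set.range autElement :=
  Set.Subset.antisymm (fun _ hM => mem_range_autElement hM)
    (Set.range_subset_iff.2 autElement_mem)

lemma card_aut_codeSet : Nat.card (Aut codeSet) = 4 := by
  change Nat.card (Aut codeSet : Set (GL (Fin 7) (ZMod 2))) = 4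
  rw [coe_aut_codeSet, Nat.card_range_of_injective autElement_injective, Nat.card_fin]

lemma isKleinFour_aut_codeSet : IsKleinFour (Aut codeSet) where
  card_four := card_aut_codeSet
  exponent_two := by
    have : Nontrivial (Aut codeSet) :=
      Finite.one_lt_card_iff_nontrivial.1 (by rw [card_aut_codeSet]; norm_num)
    refine (Monoid.exponent_eq_prime_iff Nat.prime_two).2 fun g hg => ?_
    refine orderOf_eq_prime ?_ hg
    obtain ⟨i, hi⟩ := mem_range_autElement g.2
    refine Subtype.ext ?_
    rw [pow_two, Subgroup.coe_mul, ← hi, autElement_mul_self, Subgroup.coe_one]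

/-- There is a `(7,4;3)₂` code of size 333 whose automorphism group has order 4 and is
isomorphic to the Klein four-group `Z₂ × Z₂`. -/
theorem stmt_1 :
    ∃ C : Set (Submodule (ZMod 2) V), IsCode C ∧ C.ncard = 333 ∧
      Nat.card (Aut C) = 4 ∧
      Nonempty (Aut C ≃* Multiplicative (ZMod 2 × ZMod 2)) := by
  have := isKleinFour_aut_codeSet
  exact ⟨codeSet, isCode_codeSet, by rw [Set.ncard_coe_finset, card_codeSet], card_aut_codeSet,
    IsKleinFour.nonempty_mulEquiv⟩
end

section
/- Every set C of 3-dimensional F₂-linear subspaces of F₂⁷, any two distinct members of which intersect in a subspace of dimension at most 1, that is invariant under every element of some subgroup U ≤ GL(7,F₂) of order 31, satisfies |C| ≤ 279. Moreover, this bound is attained: there exist a subgroup U ≤ GL(7,F₂) of order 31 and such a code C with |C| = 279 invariant under every element of U. -/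
namespace InvariantCode

open Finset

/-- Multiplication by a primitive element of `F₃₂` on the five low bits. -/
def rot (n : ℕ) : ℕ := n / 32 * 32 + (2 * (n % 32) ^^^ (if n % 32 < 16 then 0 else 37))

lemma rot_lt : ∀ n < 128, rot n < 128 := by decide +kernel

lemma rot_pos : ∀ n < 128, 0 < n → 0 < rot n := by decide +kernel

lemma rot_iterate_period : ∀ n < 128, rot^[31] n = n := by decide +kernel

lemma rot_div (n : ℕ) : rot n / 32 = n / 32 := by
  have h : ∀ x < 32, 2 * x ^^^ (if x < 16 then 0 else 37) < 32 := by decide +kernel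
  have := h (n % 32) (Nat.mod_lt _ (by norm_num))
  unfold rot
  omega

lemma rot_iterate_lt {n : ℕ} (hn : n < 128) (k : ℕ) : rot^[k] n < 128 := by
  induction k with
  | zero => exact hn
  | succ k ih => rw [Function.iterate_succ_apply']; exact rot_lt _ ih

lemma rot_iterate_div (n k : ℕ) : rot^[k] n / 32 = n / 32 := by
  induction k with
  | zero => rfl
  | succ k ih => rw [Function.iterate_succ_apply', rot_div, ih]

lemma rot_add (c : ℕ) {x : ℕ} (hx : x < 32) : rot (32 * c + x) = 32 * c + rot x := by
  have h1 : (32 * c + x) / 32 = c := by omega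
  have h2 : (32 * c + x) % 32 = x := by omega
  have h3 : x / 32 = 0 := by omega
  have h4 : x % 32 = x := by omega
  unfold rot
  rw [h1, h2, h3, h4]
  omega

lemma rot_iterate_lt_of_lt {x : ℕ} (hx : x < 32) (k : ℕ) : rot^[k] x < 32 := by
  have := rot_iterate_div x k
  omega

lemma rot_iterate_add (c : ℕ) {x : ℕ} (hx : x < 32) (k : ℕ) :
    rot^[k] (32 * c + x) = 32 * c + rot^[k] x := by
  induction k with
  | zero => rfl
  | succ k ih =>
    rw [Function.iterate_succ_apply', Function.iterate_succ_apply', ih,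
      rot_add _ (rot_iterate_lt_of_lt hx k)]

lemma rot_iterate_mod {n : ℕ} (hn : n < 128) (k : ℕ) : rot^[k % 31] n = rot^[k] n :=
  Function.IsPeriodicPt.iterate_mod_apply (rot_iterate_period n hn) k

/-- Discrete logarithm in `F₃₂`, read from a base-32 table. -/
def dlog (x : ℕ) : ℕ := 719976087585702537242947323940304841317326324736 / 32 ^ x % 32

/-- The inverse table of `dlog`. -/
def dexp (k : ℕ) : ℕ := 26123046934389750782758618732681130701236736065 / 32 ^ k % 32

lemma rot_iterate_eq_dexp : ∀ x < 32, 0 < x → ∀ k < 31,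
    rot^[k] x = dexp ((dlog x + k) % 31) := by decide +kernel

lemma dlog_lt : ∀ x < 32, dlog x < 31 := by decide +kernel

lemma dexp_dlog : ∀ x < 32, 0 < x → dexp (dlog x) = x := by decide +kernel

lemma rot_iterate_dlog {x y : ℕ} (hx : x < 32) (hx0 : 0 < x) (hy : y < 32) (hy0 : 0 < y) :
    rot^[(dlog y + 31 - dlog x) % 31] x = y := by
  rw [rot_iterate_eq_dexp x hx hx0 _ (Nat.mod_lt _ (by norm_num))]
  have h1 := dlog_lt x hx
  have h2 := dlog_lt y hy
  have : (dlog x + (dlog y + 31 - dlog x) % 31) % 31 = dlog y := by omega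
  rw [this, dexp_dlog y hy hy0]

lemma xor_div (a b : ℕ) : (a ^^^ b) / 32 = a / 32 ^^^ b / 32 := by
  simpa [Nat.shiftRight_eq_div_pow] using Nat.shiftRight_xor_distrib (a := a) (b := b) (i := 5)

/-- The nonzero vectors of the members of a code in `F₂⁷` that is invariant under `rot`,
vectors being encoded by their binary expansions. -/
structure IsFamily (F : Finset (Finset ℕ)) : Prop where
  pos : ∀ S ∈ F, ∀ n ∈ S, 0 < n
  lt : ∀ S ∈ F, ∀ n ∈ S, n < 128
  card_eq : ∀ S ∈ F, #S = 7
  xor_mem : ∀ S ∈ F, ∀ a ∈ S, ∀ b ∈ S, a ≠ b → a ^^^ b ∈ S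
  rot_mem : ∀ S ∈ F, S.image rot ∈ F
  eq_of_mem : ∀ S ∈ F, ∀ T ∈ F, ∀ a b, a ≠ b → a ∈ S → b ∈ S → a ∈ T → b ∈ T → S = T

/-- The elements of `S` with high bits `c`. -/
def fiber (c : ℕ) (S : Finset ℕ) : Finset ℕ := S.filter (· / 32 = c)

lemma mem_fiber {c n : ℕ} {S : Finset ℕ} : n ∈ fiber c S ↔ n ∈ S ∧ n / 32 = c := by
  simp [fiber]

namespace IsFamily

variable {F : Finset (Finset ℕ)} {S T : Finset ℕ}

lemma shift_mem (hF : IsFamily F) (hS : S ∈ F) (k : ℕ) : S.image rot^[k] ∈ F := by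
  induction k with
  | zero => simpa using hS
  | succ k ih =>
    rw [Function.iterate_succ', ← image_image]
    exact hF.rot_mem _ ih

lemma shift_shift (hF : IsFamily F) (hS : S ∈ F) {k l : ℕ} (h : (k + l) % 31 = 0) :
    (S.image rot^[k]).image rot^[l] = S := by
  rw [image_image, ← Function.iterate_add]
  conv_rhs => rw [← image_id (s := S)]
  refine image_congr fun n hn => ?_
  rw [← rot_iterate_mod (hF.lt S hS n hn), add_comm, h]
  rfl

lemma card_fiber_shift (hF : IsFamily F) (hS : S ∈ F) (c k : ℕ) :
    #(fiber c (S.image rot^[k])) = #(fiber c S) := by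
  have key : ∀ T ∈ F, ∀ l, #(fiber c (T.image rot^[l])) ≤ #(fiber c T) := by
    intro T _ l
    have : fiber c (T.image rot^[l]) = (fiber c T).image rot^[l] := by
      ext n
      simp only [mem_fiber, mem_image]
      constructor
      · rintro ⟨⟨m, hm, rfl⟩, h⟩
        exact ⟨m, ⟨hm, by rwa [rot_iterate_div] at h⟩, rfl⟩
      · rintro ⟨m, ⟨hm, h⟩, rfl⟩
        exact ⟨⟨m, hm, rfl⟩, by rwa [rot_iterate_div]⟩
    rw [this]
    exact card_image_le
  refine le_antisymm (key S hS k) ?_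
  have h := key _ (hF.shift_mem hS k) (31 - k % 31)
  rwa [hF.shift_shift hS (by omega)] at h

lemma exists_mod_ne_zero (hF : IsFamily F) (hS : S ∈ F) : ∃ s ∈ S, s % 32 ≠ 0 := by
  by_contra! h
  have hsub : S ⊆ {32, 64, 96} := by
    intro n hn
    have h1 := h n hn
    have h2 := hF.lt S hS n hn
    have h3 := hF.pos S hS n hn
    simp only [mem_insert, mem_singleton]
    omega
  have := card_le_card hsub
  rw [hF.card_eq S hS] at this
  exact absurd this (by decide)

lemma shift_ne (hF : IsFamily F) (hS : S ∈ F) {k : ℕ} (hk0 : 0 < k) (hk : k < 31) :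
    S.image rot^[k] ≠ S := by
  intro hfix
  obtain ⟨j, hj⟩ : ∃ j, k * j % 31 = 1 := by
    have : ∀ k < 31, 0 < k → ∃ j < 31, k * j % 31 = 1 := by decide
    obtain ⟨j, -, hj⟩ := this k hk hk0
    exact ⟨j, hj⟩
  have hstep : ∀ n ∈ S, rot^[k] n ∈ S := fun n hn => hfix ▸ mem_image_of_mem _ hn
  have hiter : ∀ i, ∀ n ∈ S, rot^[k * i] n ∈ S := by
    intro i
    induction i with
    | zero => intro n hn; simpa using hn
    | succ i ih =>
      intro n hn
      rw [Nat.mul_succ, Function.iterate_add_apply]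
      exact ih _ (hstep n hn)
  have hall : ∀ i, ∀ n ∈ S, rot^[i] n ∈ S := by
    intro i n hn
    have h := hiter (j * i) n hn
    have hlt := hF.lt S hS n hn
    rwa [← rot_iterate_mod hlt, ← mul_assoc, Nat.mul_mod, hj, one_mul, Nat.mod_mod,
      rot_iterate_mod hlt] at h
  obtain ⟨s, hs, hs0⟩ := hF.exists_mod_ne_zero hS
  have hsub : (Ioo 0 32).image (32 * (s / 32) + ·) ⊆ S := by
    intro n hn
    obtain ⟨y, hy, rfl⟩ := mem_image.1 hn
    rw [mem_Ioo] at hy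
    have hx : s % 32 < 32 := Nat.mod_lt _ (by norm_num)
    rw [← rot_iterate_dlog hx (Nat.pos_of_ne_zero hs0) hy.2 hy.1, ← rot_iterate_add _ hx,
      Nat.div_add_mod]
    exact hall _ s hs
  have := card_le_card hsub
  rw [card_image_of_injective _ (add_right_injective _), hF.card_eq S hS] at this
  simp at this

lemma shift_injOn (hF : IsFamily F) (hS : S ∈ F) {i j : ℕ} (hi : i < 31) (hj : j < 31)
    (h : S.image rot^[i] = S.image rot^[j]) : i = j := by
  wlog hij : i < j generalizing i j
  · by_contra hne
    exact hne (this hj hi h.symm (by omega)).symm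
  exfalso
  refine hF.shift_ne hS (k := j - i) (by omega) (by omega) ?_
  have h1 : (S.image rot^[i]).image rot^[31 - i] = (S.image rot^[j]).image rot^[31 - i] := by
    rw [h]
  rw [hF.shift_shift hS (by omega)] at h1
  refine Eq.trans ?_ h1.symm
  rw [image_image, ← Function.iterate_add]
  refine image_congr fun n hn => ?_
  have hlt := hF.lt S hS n hn
  rw [← rot_iterate_mod hlt (31 - i + j)]
  congr 2
  omega

lemma fixed_notMem (hF : IsFamily F) (hS : S ∈ F) {b : ℕ} (hb : b % 32 = 0) : b ∉ S := by
  intro hbS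
  have hb128 := hF.lt S hS b hbS
  have hfix : rot b = b := by
    have : ∀ b < 128, b % 32 = 0 → rot b = b := by decide +kernel
    exact this b hb128 hb
  have hmem : ∀ k, b ∈ S.image rot^[k] := fun k =>
    mem_image.2 ⟨b, hbS, Function.iterate_fixed hfix k⟩
  have hdisj : ((range 31 : Finset ℕ) : Set ℕ).PairwiseDisjoint
      (fun k => (S.image rot^[k]).erase b) := by
    intro i hi j hj hij
    refine disjoint_left.2 fun n hn hn' => hij ?_
    rw [mem_erase] at hn hn'
    exact hF.shift_injOn hS (by simpa using hi) (by simpa using hj)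
      (hF.eq_of_mem _ (hF.shift_mem hS i) _ (hF.shift_mem hS j) n b hn.1 hn.2 (hmem i) hn'.2
        (hmem j))
  have hcard := card_biUnion hdisj
  have hsub : (range 31).biUnion (fun k => (S.image rot^[k]).erase b) ⊆ range 128 := by
    intro n hn
    obtain ⟨k, -, hk⟩ := mem_biUnion.1 hn
    exact mem_range.2 (hF.lt _ (hF.shift_mem hS k) n (mem_of_mem_erase hk))
  have hle := card_le_card hsub
  rw [hcard, sum_congr rfl fun k _ => by
    rw [card_erase_of_mem (hmem k), hF.card_eq _ (hF.shift_mem hS k)]] at hle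
  simp at hle

lemma card_fiber_zero_ne (hF : IsFamily F) (hS : S ∈ F) : #(fiber 0 S) ≠ 7 := by
  intro h7
  have hall : ∀ k, ∀ n ∈ S.image rot^[k], n ∈ Ioo 0 32 := by
    intro k n hn
    have hT := hF.shift_mem hS k
    have hfull : fiber 0 (S.image rot^[k]) = S.image rot^[k] :=
      eq_of_subset_of_card_le (filter_subset _ _)
        (by rw [hF.card_fiber_shift hS, h7, hF.card_eq _ hT])
    rw [← hfull, mem_fiber] at hn
    have := hF.pos _ hT n hn.1
    rw [mem_Ioo]
    omega
  have hdisj : ((range 31 : Finset ℕ) : Set ℕ).PairwiseDisjoint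
      (fun k => (S.image rot^[k]).offDiag) := by
    intro i hi j hj hij
    refine disjoint_left.2 fun p hp hp' => hij ?_
    rw [mem_offDiag] at hp hp'
    exact hF.shift_injOn hS (by simpa using hi) (by simpa using hj)
      (hF.eq_of_mem _ (hF.shift_mem hS i) _ (hF.shift_mem hS j) p.1 p.2 hp.2.2 hp.1 hp.2.1
        hp'.1 hp'.2.1)
  have hcard := card_biUnion hdisj
  have hsub : (range 31).biUnion (fun k => (S.image rot^[k]).offDiag) ⊆ (Ioo 0 32).offDiag := by
    intro p hp
    obtain ⟨k, -, hk⟩ := mem_biUnion.1 hp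
    rw [mem_offDiag] at hk ⊢
    exact ⟨hall k _ hk.1, hall k _ hk.2.1, hk.2.2⟩
  have hle := card_le_card hsub
  rw [hcard, sum_congr rfl fun k _ => by
    rw [offDiag_card, hF.card_eq _ (hF.shift_mem hS k)]] at hle
  simp [offDiag_card] at hle

lemma card_fiber (hF : IsFamily F) (hS : S ∈ F) {c : ℕ} (hc : c ≠ 0) :
    #(fiber c S) = 0 ∨ #(fiber c S) = #(fiber 0 S) + 1 := by
  rcases (fiber c S).eq_empty_or_nonempty with h | ⟨s, hs⟩
  · simp [h]
  right
  rw [← card_erase_add_one hs]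
  congr 1
  rw [mem_fiber] at hs
  refine card_nbij' (s ^^^ ·) (s ^^^ ·) ?_ ?_ ?_ ?_
  · intro n hn
    simp only [coe_erase, Set.mem_sdiff, mem_coe, mem_fiber, Set.mem_singleton_iff] at hn ⊢
    refine ⟨hF.xor_mem S hS s hs.1 n hn.1.1 (Ne.symm hn.2), ?_⟩
    rw [xor_div, hs.2, hn.1.2, Nat.xor_self]
  · intro n hn
    simp only [coe_erase, Set.mem_sdiff, mem_coe, mem_fiber, Set.mem_singleton_iff] at hn ⊢
    refine ⟨⟨hF.xor_mem S hS s hs.1 n hn.1 ?_, ?_⟩, ?_⟩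
    · rintro rfl
      exact hc (hs.2.symm.trans hn.2)
    · rw [xor_div, hs.2, hn.2, Nat.xor_zero]
    · intro h
      have h0 : n = 0 := by
        have := congrArg (s ^^^ ·) h
        simpa using this
      exact (hF.pos S hS n hn.1).ne' h0
  · intro n _
    simp
  · intro n _
    simp

/-- A member meets the fixed complement of the plane `{0, 32, 64, 96}` either in a single point
and then has two points over each nonzero `c`, or in a line and has four points over one `c`. -/
lemma card_fiber_cases (hF : IsFamily F) (hS : S ∈ F) :
    (#(fiber 0 S) = 1 ∧ #(fiber 1 S) = 2 ∧ #(fiber 2 S) = 2 ∧ #(fiber 3 S) = 2) ∨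
    (#(fiber 0 S) = 3 ∧ #(fiber 1 S) = 4 ∧ #(fiber 2 S) = 0 ∧ #(fiber 3 S) = 0) ∨
    (#(fiber 0 S) = 3 ∧ #(fiber 1 S) = 0 ∧ #(fiber 2 S) = 4 ∧ #(fiber 3 S) = 0) ∨
    (#(fiber 0 S) = 3 ∧ #(fiber 1 S) = 0 ∧ #(fiber 2 S) = 0 ∧ #(fiber 3 S) = 4) := by
  have hsum : #S = ∑ c ∈ range 4, #(fiber c S) :=
    card_eq_sum_card_fiberwise fun n hn => by
      have := hF.lt S hS n hn
      simp only [coe_range, Set.mem_Iio]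
      omega
  rw [hF.card_eq S hS] at hsum
  simp only [sum_range_succ, range_zero, sum_empty] at hsum
  have h1 := hF.card_fiber hS (c := 1) (by norm_num)
  have h2 := hF.card_fiber hS (c := 2) (by norm_num)
  have h3 := hF.card_fiber hS (c := 3) (by norm_num)
  have h7 := hF.card_fiber_zero_ne hS
  generalize #(fiber 0 S) = f₀, #(fiber 1 S) = f₁, #(fiber 2 S) = f₂, #(fiber 3 S) = f₃ at *
  rcases h1 with rfl | rfl <;> rcases h2 with rfl | rfl <;> rcases h3 with rfl | rfl <;> omega

lemma card_mul_eq (hF : IsFamily F) {c r t : ℕ}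
    (ht : ∀ S ∈ F, #(fiber c S) = r → #(fiber 0 S) = t) :
    31 * #{S ∈ F | 1 ∈ S ∧ #(fiber c S) = r} = #{S ∈ F | #(fiber c S) = r} * t := by
  have hle : ∀ a ∈ Ioo 0 32, ∀ b ∈ Ioo 0 32,
      #{S ∈ F | a ∈ S ∧ #(fiber c S) = r} ≤ #{S ∈ F | b ∈ S ∧ #(fiber c S) = r} := by
    intro a ha b hb
    rw [mem_Ioo] at ha hb
    set k := (dlog b + 31 - dlog a) % 31 with hk
    refine card_le_card_of_injOn (fun S => S.image rot^[k]) ?_ ?_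
    · intro S hS
      simp only [coe_filter, Set.mem_ofPred_eq] at hS ⊢
      refine ⟨hF.shift_mem hS.1 k, ?_, by rw [hF.card_fiber_shift hS.1]; exact hS.2.2⟩
      rw [← rot_iterate_dlog ha.2 ha.1 hb.2 hb.1]
      exact mem_image_of_mem _ hS.2.1
    · intro S hS T hT h
      simp only [coe_filter, Set.mem_ofPred_eq] at hS hT h
      have hk' : k < 31 := Nat.mod_lt _ (by norm_num)
      rw [← hF.shift_shift hS.1 (k := k) (l := 31 - k) (by omega), h,
        hF.shift_shift hT.1 (by omega)]
  have h := card_mul_eq_card_mul (s := Ioo 0 32) (t := {S ∈ F | #(fiber c S) = r})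
    (fun a S => a ∈ S) (m := #{S ∈ F | 1 ∈ S ∧ #(fiber c S) = r}) (n := t) ?_ ?_
  · simpa using h
  · intro a ha
    have h1 : 1 ∈ Ioo 0 32 := by simp
    rw [← le_antisymm (hle a ha 1 h1) (hle 1 h1 a ha)]
    congr 1
    ext S
    simp only [mem_bipartiteAbove, mem_filter]
    tauto
  · intro S hS
    rw [mem_filter] at hS
    rw [← ht S hS.1 hS.2]
    congr 1
    ext n
    simp only [mem_bipartiteBelow, mem_fiber, mem_Ioo]
    constructor
    · rintro ⟨h, h'⟩
      exact ⟨h', by omega⟩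
    · rintro ⟨h, h'⟩
      exact ⟨⟨hF.pos S hS.1 n h, by omega⟩, h⟩

lemma sum_card_fiber_le (hF : IsFamily F) {c : ℕ} (hc : c ≠ 0) :
    ∑ S ∈ F with 1 ∈ S, #(fiber c S) ≤ 31 := by
  rw [← card_biUnion]
  · have hsub : (F.filter (1 ∈ ·)).biUnion (fiber c) ⊆ Ioo (32 * c) (32 * c + 32) := by
      intro n hn
      obtain ⟨S, hS, hnS⟩ := mem_biUnion.1 hn
      rw [mem_filter] at hS
      rw [mem_fiber] at hnS
      have : n % 32 ≠ 0 := fun h => hF.fixed_notMem hS.1 h hnS.1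
      rw [mem_Ioo]
      omega
    simpa using card_le_card hsub
  · intro S hS T hT hST
    rw [mem_coe, mem_filter] at hS hT
    refine disjoint_left.2 fun n hn hn' => hST ?_
    rw [mem_fiber] at hn hn'
    exact hF.eq_of_mem S hS.1 T hT.1 1 n (by rintro rfl; exact hc hn.2.symm) hS.2 hn.1 hT.2 hn'.1

lemma sum_card_fiber_zero_le (hF : IsFamily F) :
    ∑ S ∈ F with 1 ∈ S, #((fiber 0 S).erase 1) ≤ 30 := by
  rw [← card_biUnion]
  · have hsub : (F.filter (1 ∈ ·)).biUnion (fun S => (fiber 0 S).erase 1) ⊆ Ioo 1 32 := by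
      intro n hn
      obtain ⟨S, hS, hnS⟩ := mem_biUnion.1 hn
      rw [mem_filter] at hS
      rw [mem_erase, mem_fiber] at hnS
      have := hF.pos S hS.1 n hnS.2.1
      rw [mem_Ioo]
      omega
    simpa using card_le_card hsub
  · intro S hS T hT hST
    rw [mem_coe, mem_filter] at hS hT
    refine disjoint_left.2 fun n hn hn' => hST ?_
    rw [mem_erase, mem_fiber] at hn hn'
    exact hF.eq_of_mem S hS.1 T hT.1 1 n hn.1.symm hS.2 hn.2.1 hT.2 hn'.2.1

lemma card_transversal_le (hF : IsFamily F) : #{S ∈ F | #(fiber 0 S) = 1} * 4 ≤ 930 := by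
  have hcard := card_biUnion (s := {S ∈ F | #(fiber 0 S) = 1})
    (t := fun S => fiber 1 S ×ˢ fiber 2 S) ?_
  · rw [sum_const_nat (m := 4)] at hcard
    · rw [← hcard]
      have hsub : ({S ∈ F | #(fiber 0 S) = 1}).biUnion (fun S => fiber 1 S ×ˢ fiber 2 S) ⊆
          {p ∈ Ioo 32 64 ×ˢ Ioo 64 96 | p.1 ^^^ p.2 ≠ 96} := by
        intro p hp
        obtain ⟨S, hS, hpS⟩ := mem_biUnion.1 hp
        rw [mem_filter] at hS
        rw [mem_product, mem_fiber, mem_fiber] at hpS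
        have h1 : p.1 % 32 ≠ 0 := fun h => hF.fixed_notMem hS.1 h hpS.1.1
        have h2 : p.2 % 32 ≠ 0 := fun h => hF.fixed_notMem hS.1 h hpS.2.1
        have h3 : p.1 ^^^ p.2 ≠ 96 := fun h => hF.fixed_notMem hS.1 (b := 96) rfl
          (h ▸ hF.xor_mem S hS.1 _ hpS.1.1 _ hpS.2.1 (by rintro h; have := hpS.2.2; omega))
        simp only [mem_filter, mem_product, mem_Ioo]
        refine ⟨?_, h3⟩
        omega
      refine (card_le_card hsub).trans (le_of_eq ?_)
      decide +kernel
    · intro S hS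
      rw [mem_filter] at hS
      have := hF.card_fiber_cases hS.1
      rw [card_product, show #(fiber 1 S) = 2 by omega, show #(fiber 2 S) = 2 by omega]
  · intro S hS T hT hST
    simp only [coe_filter, Set.mem_ofPred_eq] at hS hT
    refine disjoint_left.2 fun p hp hp' => hST ?_
    rw [mem_product, mem_fiber, mem_fiber] at hp hp'
    exact hF.eq_of_mem S hS.1 T hT.1 p.1 p.2 (by rintro h; have := hp.2.2; omega)
      hp.1.1 hp.2.1 hp'.1.1 hp'.2.1

/-- The only distribution of types that a family with more than nine orbits could have. -/
lemma types_of_card (hF : IsFamily F) (h : 279 < #F) :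
    #{S ∈ F | 1 ∈ S ∧ #(fiber 0 S) = 1} = 7 ∧
    (∃ S ∈ F, 1 ∈ S ∧ #(fiber 1 S) = 4) ∧ ∃ S ∈ F, 1 ∈ S ∧ #(fiber 2 S) = 4 := by
  have hmul1 := hF.card_mul_eq (c := 0) (r := 1) (t := 1) fun _ _ h => h
  have hmul2 : ∀ c, c = 1 ∨ c = 2 ∨ c = 3 → 31 * #{S ∈ F | 1 ∈ S ∧ #(fiber c S) = 4} =
      #{S ∈ F | #(fiber c S) = 4} * 3 := by
    intro c hc
    refine hF.card_mul_eq fun S hS h4 => ?_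
    have := hF.card_fiber_cases hS
    rcases hc with rfl | rfl | rfl <;> omega
  have htot : #F = #{S ∈ F | #(fiber 0 S) = 1} + #{S ∈ F | #(fiber 1 S) = 4} +
      #{S ∈ F | #(fiber 2 S) = 4} + #{S ∈ F | #(fiber 3 S) = 4} := by
    simp only [card_filter, ← sum_add_distrib]
    rw [card_eq_sum_ones]
    refine sum_congr rfl fun S hS => ?_
    have := hF.card_fiber_cases hS
    split_ifs <;> omega
  have hpt : ∀ c, c = 1 ∨ c = 2 ∨ c = 3 → 2 * #{S ∈ F | 1 ∈ S ∧ #(fiber 0 S) = 1} +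
      4 * #{S ∈ F | 1 ∈ S ∧ #(fiber c S) = 4} ≤ 31 := by
    intro c hc
    refine le_trans ?_ (hF.sum_card_fiber_le (c := c) (by omega))
    simp only [← filter_filter, card_filter _ (F.filter (1 ∈ ·)), mul_sum, ← sum_add_distrib]
    refine sum_le_sum fun S hS => ?_
    have := hF.card_fiber_cases (mem_filter.1 hS).1
    rcases hc with rfl | rfl | rfl <;> split_ifs <;> omega
  have hline : 2 * #{S ∈ F | 1 ∈ S ∧ #(fiber 1 S) = 4} + 2 * #{S ∈ F | 1 ∈ S ∧ #(fiber 2 S) = 4} +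
      2 * #{S ∈ F | 1 ∈ S ∧ #(fiber 3 S) = 4} ≤ 30 := by
    refine le_trans ?_ hF.sum_card_fiber_zero_le
    simp only [← filter_filter, card_filter _ (F.filter (1 ∈ ·)), mul_sum, ← sum_add_distrib]
    refine sum_le_sum fun S hS => ?_
    have hS' := mem_filter.1 hS
    have := hF.card_fiber_cases hS'.1
    rw [card_erase_of_mem (mem_fiber (c := 0) |>.2 ⟨hS'.2, rfl⟩)]
    split_ifs <;> omega
  have htrans := hF.card_transversal_le
  have m1 := hmul2 1 (by norm_num)
  have m2 := hmul2 2 (by norm_num)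
  have m3 := hmul2 3 (by norm_num)
  have p1 := hpt 1 (by norm_num)
  have p2 := hpt 2 (by norm_num)
  have p3 := hpt 3 (by norm_num)
  have hex : ∀ c, 0 < #{S ∈ F | 1 ∈ S ∧ #(fiber c S) = 4} →
      ∃ S ∈ F, 1 ∈ S ∧ #(fiber c S) = 4 := by
    intro c hc
    obtain ⟨S, hS⟩ := card_pos.1 hc
    exact ⟨S, mem_filter.1 hS⟩
  refine ⟨by omega, hex 1 (by omega), hex 2 (by omega)⟩

lemma xor_one_mem (hF : IsFamily F) (hS : S ∈ F) (h1 : 1 ∈ S) {n : ℕ} (hn : n ∈ S) (hn1 : n ≠ 1) :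
    n ^^^ 1 ∈ S :=
  hF.xor_mem S hS n hn 1 h1 hn1

end IsFamily

lemma add_xor (c : ℕ) {x y : ℕ} (hx : x < 32) (hy : y < 32) :
    (32 * c + x) ^^^ y = 32 * c + (x ^^^ y) := by
  have hx' : x < 2 ^ 5 := hx
  have hxy : x ^^^ y < 2 ^ 5 := Nat.xor_lt_two_pow hx hy
  have h := Nat.two_pow_add_eq_or_of_lt hx' c
  have h' := Nat.two_pow_add_eq_or_of_lt hxy c
  norm_num at h h'
  refine Nat.eq_of_testBit_eq fun i => ?_
  have hy' : y < 2 ^ 5 := hy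
  rw [h, h']
  have hd : (32 * c).testBit i = (decide (5 ≤ i) && c.testBit (i - 5)) := by
    simpa using Nat.testBit_two_pow_mul (i := 5) (a := c) (j := i)
  by_cases hi : 5 ≤ i
  · have h0 : y.testBit i = false :=
      Nat.testBit_lt_two_pow (hy'.trans_le (Nat.pow_le_pow_right (by norm_num) hi))
    simp [h0]
  · simp [hd, hi]

lemma xor_one : ∀ n < 128, n ^^^ 1 = if n % 2 = 0 then n + 1 else n - 1 := by decide +kernel

/-- Representatives of the nonzero classes of `F₃₂` modulo `F₂`. -/
def evens : List ℕ := (List.range 15).map fun i => 2 * i + 2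

lemma mem_evens {x : ℕ} : x ∈ evens ↔ x % 2 = 0 ∧ 0 < x ∧ x < 32 := by
  simp only [evens, List.mem_map, List.mem_range]
  constructor
  · rintro ⟨i, hi, rfl⟩
    omega
  · intro h
    exact ⟨x / 2 - 1, by omega, by omega⟩

/-- The logarithm of the quotient of two nonzero elements of `F₃₂`. -/
def ratio (x y : ℕ) : ℕ := (dlog x + 31 - dlog y) % 31

/-- The number whose binary digits are indexed by the list `l`. -/
def mask (l : List ℕ) : ℕ := l.foldr (fun i m => Nat.lor (2 ^ i) m) 0

lemma testBit_mask (l : List ℕ) (i : ℕ) : (mask l).testBit i = decide (i ∈ l) := by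
  induction l with
  | nil => simp [mask]
  | cons j l ih =>
    have : mask (j :: l) = 2 ^ j ||| mask l := rfl
    rw [this, Nat.testBit_or, ih, Nat.testBit_two_pow]
    by_cases h : j = i
    · simp [h]
    · simp [h, Ne.symm h]

lemma land_mask {l l' : List ℕ} (h : ∀ i ∈ l, i ∉ l') : Nat.land (mask l) (mask l') = 0 := by
  refine Nat.eq_of_testBit_eq fun i => ?_
  change (mask l &&& mask l').testBit i = _
  rw [Nat.testBit_and, testBit_mask, testBit_mask, Nat.zero_testBit]
  by_cases hi : i ∈ l
  · simp [h i hi]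
  · simp [hi]

/-- The line orbits met by the member spanned by `1`, `32 + x`, `64 + y`. -/
def bits (x y : ℕ) : List ℕ :=
  [ratio x y, ratio (x ^^^ 1) y, ratio x (y ^^^ 1), ratio (x ^^^ 1) (y ^^^ 1),
    32 + y / 2, 48 + (x ^^^ y) / 2]

/-- The masks of all members through `1` and `32 + x` that have a single point below `32`. -/
def group (x : ℕ) : List ℕ :=
  (evens.filter fun y => !Nat.beq x y).map fun y => mask (bits x y)

/-- Whether `k (used ||| m)` holds for some `m ∈ ms` that is disjoint from `used`. It is written
with recursors, and evaluates `used ||| m` before passing it on, to be fast in the kernel. -/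
noncomputable def pick (k : ℕ → Bool) (used : ℕ) (ms : List ℕ) : Bool :=
  List.rec (motive := fun _ => Bool) false
    (fun m _ ih => Bool.rec (motive := fun _ => Bool) ih
      (Bool.rec (motive := fun _ => Bool) ih true
        (Nat.rec (motive := fun _ => Bool) true (fun n _ => k n) (Nat.add (Nat.lor used m) 1)))
      (Nat.beq (Nat.land m used) 0)) ms

/-- Whether disjoint masks can be picked from `group x` for all but `skip` many `x ∈ xs` outside
`f`, such that some `h ∈ L` is disjoint from all of them. -/
noncomputable def search (L : List ℕ) (f : ℕ) (xs : List ℕ) : ℕ → ℕ → Bool :=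
  List.rec (motive := fun _ => ℕ → ℕ → Bool)
    (fun _ used => L.any fun h => Nat.beq (Nat.land h used) 0)
    (fun x _ ih skip used => Bool.rec (motive := fun _ => Bool)
      (Bool.rec (motive := fun _ => Bool) (pick (ih skip) used (group x)) true
        (Nat.rec (motive := fun _ => Bool) false (fun s _ => ih s used) skip))
      (ih skip used) (Nat.testBit f (x / 2))) xs

lemma pick_eq_true {k : ℕ → Bool} {used m : ℕ} {ms : List ℕ} (hm : m ∈ ms)
    (hd : Nat.land m used = 0) (hk : k (Nat.lor used m) = true) : pick k used ms = true := by
  induction ms with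
  | nil => simp at hm
  | cons a ms ih =>
    change Bool.rec (motive := fun _ => Bool) (pick k used ms)
      (Bool.rec (motive := fun _ => Bool) (pick k used ms) true (k (Nat.lor used a)))
      (Nat.beq (Nat.land a used) 0) = true
    rcases List.mem_cons.1 hm with rfl | hm
    · rw [hd, hk]
      rfl
    · rw [ih hm]
      cases Nat.beq (Nat.land a used) 0 <;> cases k (Nat.lor used a) <;> rfl

open Classical in
lemma search_eq_true {P : ℕ → ℕ → Prop} {L : List ℕ} {f h : ℕ} (hL : h ∈ L)
    (hP : ∀ x y, P x y → y ∈ evens ∧ x ≠ y)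
    (hd : ∀ x y x' y', P x y → P x' y' → x ≠ x' →
      Nat.land (mask (bits x y)) (mask (bits x' y')) = 0)
    (hh : ∀ x y, P x y → Nat.land h (mask (bits x y)) = 0) (xs : List ℕ) (hxs : xs.Nodup) :
    ∀ skip used, xs.countP (fun x => decide (Nat.testBit f (x / 2) = false ∧ ¬∃ y, P x y)) ≤ skip →
      Nat.land h used = 0 →
      (∀ x ∈ xs, ∀ y, P x y → Nat.land (mask (bits x y)) used = 0) →
      search L f xs skip used = true := by
  induction xs with
  | nil =>
    intro skip used _ hu _
    exact List.any_eq_true.2 ⟨h, hL, by rw [hu]; rfl⟩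
  | cons x xs ih =>
    intro skip used hcount hu hused
    rw [List.nodup_cons] at hxs
    rw [List.countP_cons] at hcount
    have hused' : ∀ x' ∈ xs, ∀ y, P x' y → Nat.land (mask (bits x' y)) used = 0 :=
      fun x' hx' => hused x' (List.mem_cons_of_mem _ hx')
    change Bool.rec (motive := fun _ => Bool)
      (Bool.rec (motive := fun _ => Bool) (pick (search L f xs skip) used (group x)) true
        (Nat.rec (motive := fun _ => Bool) false (fun s _ => search L f xs s used) skip))
      (search L f xs skip used) (Nat.testBit f (x / 2)) = true
    cases hx : Nat.testBit f (x / 2) with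
    | true => exact ih hxs.2 skip used (le_of_add_le_left hcount) hu hused'
    | false =>
      by_cases hy : ∃ y, P x y
      · obtain ⟨y, hy⟩ := hy
        have hpick : pick (search L f xs skip) used (group x) = true := by
          refine pick_eq_true (m := mask (bits x y)) ?_ (hused x (List.mem_cons_self) y hy) ?_
          · refine List.mem_map.2 ⟨y, List.mem_filter.2 ⟨(hP x y hy).1, ?_⟩, rfl⟩
            have hne := Bool.eq_false_iff.2 fun h => (hP x y hy).2 (Nat.eq_of_beq_eq_true h)
            simp only [hne, Bool.not_false]
          · refine ih hxs.2 skip _ (le_of_add_le_left hcount) ?_ ?_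
            · change h &&& (used ||| mask (bits x y)) = 0
              rw [Nat.and_or_distrib_left, show h &&& used = 0 from hu,
                show h &&& mask (bits x y) = 0 from hh x y hy, Nat.or_self]
            · intro x' hx' y' hy'
              change mask (bits x' y') &&& (used ||| mask (bits x y)) = 0
              rw [Nat.and_or_distrib_left,
                show mask (bits x' y') &&& used = 0 from hused' x' hx' y' hy',
                show mask (bits x' y') &&& mask (bits x y) = 0 from
                  hd x' y' x y hy' hy (by rintro rfl; exact hxs.1 hx'), Nat.or_self]
        rw [hpick]
        cases (Nat.rec (motive := fun _ => Bool) false (fun s _ => search L f xs s used) skip) <;>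
          rfl
      · rw [if_pos (by simp [hx]; simpa using hy)] at hcount
        obtain ⟨s, rfl⟩ : ∃ s, skip = s + 1 := ⟨skip - 1, by omega⟩
        have hs := ih hxs.2 s used (by omega) hu hused'
        change Bool.rec (motive := fun _ => Bool) _ true (search L f xs s used) = true
        rw [hs]

/-- Pairs `(p, d)` such that a member containing `1`, `m`, `32 * c + u` contains the line through
`d`, `32 * c + p`. -/
def flags (u m : ℕ) : List (ℕ × ℕ) :=
  [(u, 1), (u ^^^ m, 1), (u, m), (u ^^^ 1, m), (u, m ^^^ 1), (u ^^^ 1, m ^^^ 1)]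

/-- The class of `p / d` modulo `F₂`. -/
def cls (p : ℕ × ℕ) : ℕ := dexp (ratio p.1 p.2) / 2

/-- The classes blocked by a member containing `1`, `m`, `32 * c + u`. -/
def blocked (u m : ℕ) : ℕ := mask ((flags u m).map cls)

/-- The classes blocked over `64`, by all possible members. -/
def blockedMasks : List ℕ := evens.flatMap fun u => (evens.filter fun m => !Nat.beq u m).map
  fun m => mask ((flags u m).map fun p => 32 + cls p)

/-- Representatives, up to the Frobenius automorphism, of the values of `blocked`. -/
def blockedReps : List ℕ := [3016, 5324, 5538, 7520]

lemma search_eq_false : ∀ f ∈ blockedReps, search blockedMasks f evens 2 0 = false := by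
  decide +kernel

lemma card_unblocked : ∀ f ∈ blockedReps,
    #{x ∈ evens.toFinset | Nat.testBit f (x / 2) = false} = 9 := by
  decide +kernel

/-- `S` contains the line through `p.2` and `32 * c + p.1`. -/
structure IsFlag (c : ℕ) (S : Finset ℕ) (p : ℕ × ℕ) : Prop where
  fst_pos : 0 < p.1
  fst_lt : p.1 < 32
  snd_pos : 0 < p.2
  snd_lt : p.2 < 32
  fst_mem : 32 * c + p.1 ∈ S
  snd_mem : p.2 ∈ S

/-- `S` is a member of `F` spanned by `1`, `32 + x`, `64 + y`. -/
structure Spanned (F : Finset (Finset ℕ)) (S : Finset ℕ) (x y : ℕ) : Prop where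
  mem : S ∈ F
  card_fiber : #(fiber 0 S) = 1
  one_mem : 1 ∈ S
  left_even : x ∈ evens
  right_even : y ∈ evens
  left_mem : 32 * 1 + x ∈ S
  right_mem : 32 * 2 + y ∈ S

lemma ratio_lt (x y : ℕ) : ratio x y < 31 := Nat.mod_lt _ (by norm_num)

lemma cls_lt (p : ℕ × ℕ) : cls p < 16 := by
  have : dexp (ratio p.1 p.2) < 32 := Nat.mod_lt _ (by norm_num)
  unfold cls
  omega

lemma cls_one {x : ℕ} (hx : x < 32) (hx0 : 0 < x) : cls (x, 1) = x / 2 := by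
  have : ratio x 1 = dlog x := by
    have h1 := dlog_lt x hx
    have h2 : dlog 1 = 0 := by decide
    unfold ratio
    omega
  rw [cls, this, dexp_dlog x hx hx0]

lemma rot_iterate_ratio {x d : ℕ} (hx : x < 32) (hx0 : 0 < x) (hd : d < 32) :
    rot^[ratio 1 d] x = dexp (ratio x d) := by
  rw [rot_iterate_eq_dexp x hx hx0 _ (ratio_lt _ _)]
  have h1 := dlog_lt x hx
  have h2 := dlog_lt d hd
  have h3 : dlog 1 = 0 := by decide
  unfold ratio
  congr 1
  omega

lemma eq_of_ratio_one {d e : ℕ} (hd : d < 32) (hd0 : 0 < d) (he : e < 32) (he0 : 0 < e)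
    (h : ratio 1 d = ratio 1 e) : d = e := by
  have h1 := dlog_lt d hd
  have h2 := dlog_lt e he
  have h3 : dlog 1 = 0 := by decide
  unfold ratio at h
  rw [← dexp_dlog d hd hd0, ← dexp_dlog e he he0]
  congr 1
  omega

lemma xor_mem_evens : ∀ x ∈ evens, ∀ y ∈ evens, x ≠ y → x ^^^ y ∈ evens := by
  decide +kernel

lemma xor_one_of_mem_evens {x : ℕ} (hx : x ∈ evens) : x ^^^ 1 = x + 1 := by
  revert x
  decide +kernel

namespace IsFamily

variable {F : Finset (Finset ℕ)} {S T : Finset ℕ}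

lemma eq_one_of_lt (h0 : #(fiber 0 S) = 1) (h1 : 1 ∈ S) {n : ℕ} (hn : n ∈ S) (hlt : n < 32) :
    n = 1 :=
  card_le_one.1 h0.le n (mem_fiber.2 ⟨hn, by omega⟩) 1 (mem_fiber.2 ⟨h1, rfl⟩)

lemma add_mem_shift {c x : ℕ} (hx : x < 32) (h : 32 * c + x ∈ S) (k : ℕ) :
    32 * c + rot^[k] x ∈ S.image rot^[k] := by
  rw [← rot_iterate_add c hx]
  exact mem_image_of_mem _ h

lemma add_xor_mem (hF : IsFamily F) (hS : S ∈ F) {c x y : ℕ} (hc : c ≠ 0) (hx : x < 32)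
    (hy : y < 32) (hxS : 32 * c + x ∈ S) (hyS : y ∈ S) : 32 * c + (x ^^^ y) ∈ S := by
  rw [← add_xor c hx hy]
  exact hF.xor_mem S hS _ hxS _ hyS (by omega)

lemma exists_even (hF : IsFamily F) (hS : S ∈ F) (h1 : 1 ∈ S) {c : ℕ} (hc : c ≠ 0)
    (hne : (fiber c S).Nonempty) : ∃ x ∈ evens, 32 * c + x ∈ S := by
  obtain ⟨n, hn⟩ := hne
  rw [mem_fiber] at hn
  have hmod : n % 32 ≠ 0 := fun h => hF.fixed_notMem hS h hn.1
  rcases Nat.mod_two_eq_zero_or_one n with h | h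
  · refine ⟨n % 32, mem_evens.2 ⟨by omega, by omega, by omega⟩, ?_⟩
    rw [← hn.2, Nat.div_add_mod]
    exact hn.1
  · have hmem := hF.xor_one_mem hS h1 hn.1 (by rintro rfl; exact hc hn.2.symm)
    rw [xor_one n (hF.lt S hS n hn.1), if_neg (by omega)] at hmem
    have hmod' : (n - 1) % 32 ≠ 0 := fun h => hF.fixed_notMem hS h hmem
    refine ⟨(n - 1) % 32, mem_evens.2 ⟨by omega, by omega, by omega⟩, ?_⟩
    convert hmem using 1
    omega

lemma mem_of_div_two_eq (hF : IsFamily F) (hS : S ∈ F) (h1 : 1 ∈ S) {c x y : ℕ} (hc : c ≠ 0)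
    (hx : x < 32) (hy : y < 32) (hxS : 32 * c + x ∈ S) (h : x / 2 = y / 2) : 32 * c + y ∈ S := by
  rcases eq_or_ne x y with rfl | hne
  · exact hxS
  · have hmem := hF.add_xor_mem hS hc hx (by norm_num) hxS h1
    rw [xor_one x (by omega)] at hmem
    convert hmem using 2
    split_ifs <;> omega

lemma shift_eq_of_cls (hF : IsFamily F) (hS : S ∈ F) (hT : T ∈ F) {c : ℕ} (hc : c ≠ 0)
    {p q : ℕ × ℕ} (hp : IsFlag c S p) (hq : IsFlag c T q) (h : cls p = cls q) :
    S.image rot^[ratio 1 p.2] = T.image rot^[ratio 1 q.2] := by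
  have one_mem : ∀ {R : Finset ℕ} {r : ℕ × ℕ}, IsFlag c R r → 1 ∈ R.image rot^[ratio 1 r.2] := by
    intro R r hr
    have := mem_image_of_mem rot^[ratio 1 r.2] hr.snd_mem
    rwa [show rot^[ratio 1 r.2] r.2 = 1 from
      rot_iterate_dlog hr.snd_lt hr.snd_pos (by norm_num) (by norm_num)] at this
  have hp' := add_mem_shift hp.fst_lt hp.fst_mem (ratio 1 p.2)
  have hq' := add_mem_shift hq.fst_lt hq.fst_mem (ratio 1 q.2)
  have hdiv : rot^[ratio 1 p.2] p.1 / 2 = rot^[ratio 1 q.2] q.1 / 2 := by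
    rwa [rot_iterate_ratio hp.fst_lt hp.fst_pos hp.snd_lt,
      rot_iterate_ratio hq.fst_lt hq.fst_pos hq.snd_lt]
  have hSk := hF.shift_mem hS (ratio 1 p.2)
  have hTk := hF.shift_mem hT (ratio 1 q.2)
  refine hF.eq_of_mem _ hSk _ hTk 1 _ ?_ (one_mem hp)
    (hF.mem_of_div_two_eq hSk (one_mem hp) hc (rot_iterate_lt_of_lt hp.fst_lt _)
      (rot_iterate_lt_of_lt hq.fst_lt _) hp' hdiv) (one_mem hq) hq'
  omega

lemma ne_of_add_mem (hF : IsFamily F) (hS : S ∈ F) {c u m : ℕ} (hc : c ≠ 0) (hu : u < 32)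
    (huS : 32 * c + u ∈ S) (hmS : m ∈ S) : u ≠ m := by
  rintro rfl
  have := hF.add_xor_mem hS hc hu hu huS hmS
  rw [Nat.xor_self] at this
  exact hF.fixed_notMem hS (by omega) this

lemma isFlag_of_mem_flags (hF : IsFamily F) (hS : S ∈ F) (h1 : 1 ∈ S) {c u m : ℕ} (hc : c ≠ 0)
    (hu : u < 32) (hm : m < 32) (hm1 : m ≠ 1) (huS : 32 * c + u ∈ S) (hmS : m ∈ S) {p : ℕ × ℕ}
    (hp : p ∈ flags u m) : IsFlag c S p := by
  have hlt : ∀ x < 32, ∀ y < 32, x ^^^ y < 32 := fun x hx y hy =>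
    Nat.xor_lt_two_pow (n := 5) hx hy
  have hm1S := hF.xor_one_mem hS h1 hmS hm1
  have hu1S := hF.add_xor_mem hS hc hu (by norm_num) huS h1
  have humS := hF.add_xor_mem hS hc hu hm huS hmS
  suffices h : p.1 < 32 ∧ p.2 < 32 ∧ 32 * c + p.1 ∈ S ∧ p.2 ∈ S by
    refine ⟨?_, h.1, hF.pos S hS _ h.2.2.2, h.2.1, h.2.2.1, h.2.2.2⟩
    by_contra h0
    exact hF.fixed_notMem hS (by omega) h.2.2.1
  simp only [flags, List.mem_cons, List.not_mem_nil, or_false] at hp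
  rcases hp with rfl | rfl | rfl | rfl | rfl | rfl <;>
    refine ⟨?_, ?_, ?_, ?_⟩ <;>
    first | assumption | exact hlt _ hu _ hm | exact hlt _ hu 1 (by norm_num) |
      exact hlt _ hm 1 (by norm_num) | norm_num

lemma cls_ne (hF : IsFamily F) (hS : S ∈ F) (hT : T ∈ F) (h1 : 1 ∈ T) {c x : ℕ} (hc : c ≠ 0)
    (hx : x ∈ evens) (hxT : 32 * c + x ∈ T) (hST : #(fiber 0 S) ≠ #(fiber 0 T)) {p : ℕ × ℕ}
    (hp : IsFlag c S p) : cls p ≠ x / 2 := by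
  intro h
  have hx' := mem_evens.1 hx
  have := hF.shift_eq_of_cls hS hT hc hp (q := (x, 1))
    ⟨hx'.2.1, hx'.2.2, by norm_num, by norm_num, hxT, h1⟩ (by rw [h, cls_one hx'.2.2 hx'.2.1])
  refine hST ?_
  rw [← hF.card_fiber_shift hS 0 (ratio 1 p.2), this, hF.card_fiber_shift hT]

lemma snd_eq_of_cls_eq (hF : IsFamily F) (hS : S ∈ F) {c : ℕ} (hc : c ≠ 0) {p q : ℕ × ℕ}
    (hp : IsFlag c S p) (hq : IsFlag c S q) (h : cls p = cls q) : p.2 = q.2 :=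
  eq_of_ratio_one hp.snd_lt hp.snd_pos hq.snd_lt hq.snd_pos
    (hF.shift_injOn hS (ratio_lt _ _) (ratio_lt _ _) (hF.shift_eq_of_cls hS hS hc hp hq h))

lemma eq_of_ratio_eq (hF : IsFamily F) (hS : S ∈ F) (hT : T ∈ F) (hS1 : 1 ∈ S) (hT1 : 1 ∈ T)
    (hT0 : #(fiber 0 T) = 1) {x y x' y' : ℕ} (hx : IsFlag 1 S (x, 1)) (hy : IsFlag 2 S (y, 1))
    (hx' : IsFlag 1 T (x', 1)) (hy' : IsFlag 2 T (y', 1)) (h : ratio x y = ratio x' y') :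
    S = T := by
  set k := (dlog x' + 31 - dlog x) % 31 with hk
  have hk' : k = (dlog y' + 31 - dlog y) % 31 := by
    have h1 := dlog_lt x hx.fst_lt
    have h2 := dlog_lt y hy.fst_lt
    have h3 := dlog_lt x' hx'.fst_lt
    have h4 := dlog_lt y' hy'.fst_lt
    unfold ratio at h
    omega
  have hxk := add_mem_shift hx.fst_lt hx.fst_mem k
  have hyk := add_mem_shift hy.fst_lt hy.fst_mem k
  rw [show rot^[k] (x, 1).1 = x' from
    rot_iterate_dlog hx.fst_lt hx.fst_pos hx'.fst_lt hx'.fst_pos] at hxk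
  rw [hk', show rot^[(dlog y' + 31 - dlog y) % 31] (y, 1).1 = y' from
    rot_iterate_dlog hy.fst_lt hy.fst_pos hy'.fst_lt hy'.fst_pos, ← hk'] at hyk
  have hlt := hx'.fst_lt
  have hlt' := hy'.fst_lt
  have heq := hF.eq_of_mem _ (hF.shift_mem hS k) T hT _ _ (by dsimp only at *; omega)
    hxk hyk hx'.fst_mem hy'.fst_mem
  have hone : rot^[k] 1 = 1 := eq_one_of_lt hT0 hT1 (heq ▸ mem_image_of_mem _ hS1)
    (rot_iterate_lt_of_lt (by norm_num) k)
  have hzero : ∀ k < 31, rot^[k] 1 = 1 → k = 0 := by decide +kernel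
  rw [hzero k (Nat.mod_lt _ (by norm_num)) hone] at heq
  simpa using heq

end IsFamily

namespace Spanned

variable {F : Finset (Finset ℕ)} {S T : Finset ℕ} {x y x' y' : ℕ}

lemma xor_mem (h : Spanned F S x y) (hF : IsFamily F) : 32 * 3 + (x ^^^ y) ∈ S := by
  have key : ∀ x ∈ evens, ∀ y ∈ evens,
      (32 * 1 + x) ^^^ (32 * 2 + y) = 32 * 3 + (x ^^^ y) := by decide +kernel
  rw [← key x h.left_even y h.right_even]
  have := (mem_evens.1 h.left_even).2.2
  exact hF.xor_mem S h.mem _ h.left_mem _ h.right_mem (by omega)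

lemma ne (h : Spanned F S x y) (hF : IsFamily F) : x ≠ y := by
  rintro rfl
  have := h.xor_mem hF
  rw [Nat.xor_self] at this
  exact hF.fixed_notMem h.mem rfl this

lemma left_unique (h : Spanned F S x y) (h' : Spanned F S x' y') (hF : IsFamily F) : x = x' := by
  by_contra hne
  have key : ∀ x ∈ evens, ∀ y ∈ evens, (32 * 1 + x) ^^^ (32 * 1 + y) = x ^^^ y := by
    decide +kernel
  have hmem := hF.xor_mem S h.mem _ h.left_mem _ h'.left_mem (by omega)
  rw [key x h.left_even x' h'.left_even] at hmem
  have hx := mem_evens.1 (xor_mem_evens x h.left_even x' h'.left_even hne)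
  have := IsFamily.eq_one_of_lt h.card_fiber h.one_mem hmem hx.2.2
  omega

lemma exists_ratio (h : Spanned F S x y) (hF : IsFamily F) {i : ℕ} (hi : i ∈ bits x y) :
    (∃ X Y, i = ratio X Y ∧ IsFlag 1 S (X, 1) ∧ IsFlag 2 S (Y, 1)) ∨
      i = 32 + y / 2 ∨ i = 48 + (x ^^^ y) / 2 := by
  have hx := mem_evens.1 h.left_even
  have hy := mem_evens.1 h.right_even
  have hx1 := hF.add_xor_mem h.mem (by norm_num) hx.2.2 (by norm_num) h.left_mem h.one_mem
  have hy1 := hF.add_xor_mem h.mem (by norm_num) hy.2.2 (by norm_num) h.right_mem h.one_mem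
  rw [xor_one_of_mem_evens h.left_even] at hx1
  rw [xor_one_of_mem_evens h.right_even] at hy1
  have fx : IsFlag 1 S (x, 1) := ⟨hx.2.1, hx.2.2, one_pos, by norm_num, h.left_mem, h.one_mem⟩
  have fy : IsFlag 2 S (y, 1) := ⟨hy.2.1, hy.2.2, one_pos, by norm_num, h.right_mem, h.one_mem⟩
  have fx1 : IsFlag 1 S (x + 1, 1) :=
    ⟨by omega, by dsimp only; omega, one_pos, by norm_num, hx1, h.one_mem⟩
  have fy1 : IsFlag 2 S (y + 1, 1) :=
    ⟨by omega, by dsimp only; omega, one_pos, by norm_num, hy1, h.one_mem⟩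
  simp only [bits, List.mem_cons, List.not_mem_nil, or_false, xor_one_of_mem_evens h.left_even,
    xor_one_of_mem_evens h.right_even] at hi
  rcases hi with hi | hi | hi | hi | hi | hi
  · exact .inl ⟨_, _, hi, fx, fy⟩
  · exact .inl ⟨_, _, hi, fx1, fy⟩
  · exact .inl ⟨_, _, hi, fx, fy1⟩
  · exact .inl ⟨_, _, hi, fx1, fy1⟩
  · exact .inr (.inl hi)
  · exact .inr (.inr hi)

lemma bits_disjoint (h : Spanned F S x y) (h' : Spanned F T x' y') (hF : IsFamily F)
    (hne : x ≠ x') : ∀ i ∈ bits x y, i ∉ bits x' y' := by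
  intro i hi hi'
  have hST : S ≠ T := by
    rintro rfl
    exact hne (h.left_unique h' hF)
  have hy := mem_evens.1 h.right_even
  have hy' := mem_evens.1 h'.right_even
  have hz := mem_evens.1 (xor_mem_evens x h.left_even y h.right_even (h.ne hF))
  have hz' := mem_evens.1 (xor_mem_evens x' h'.left_even y' h'.right_even (h'.ne hF))
  rcases h.exists_ratio hF hi with ⟨X, Y, rfl, hX, hY⟩ | rfl | rfl <;>
    rcases h'.exists_ratio hF hi' with ⟨X', Y', he, hX', hY'⟩ | he | he
  · exact hST (hF.eq_of_ratio_eq h.mem h'.mem h.one_mem h'.one_mem h'.card_fiber hX hY hX' hY' he)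
  · have := ratio_lt X Y
    omega
  · have := ratio_lt X Y
    omega
  · have := ratio_lt X' Y'
    omega
  · obtain rfl : y = y' := by omega
    exact hST (hF.eq_of_mem S h.mem T h'.mem 1 _ (by omega) h.one_mem h.right_mem h'.one_mem
      h'.right_mem)
  · omega
  · have := ratio_lt X' Y'
    omega
  · omega
  · have heq : x ^^^ y = x' ^^^ y' := by omega
    exact hST (hF.eq_of_mem S h.mem T h'.mem 1 (32 * 3 + (x ^^^ y)) (by omega) h.one_mem
      (h.xor_mem hF) h'.one_mem (heq ▸ h'.xor_mem hF))

end Spanned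

namespace IsFamily

variable {F : Finset (Finset ℕ)} {S T : Finset ℕ}

lemma exists_spanned (hF : IsFamily F) (hS : S ∈ F) (h1 : 1 ∈ S) (h0 : #(fiber 0 S) = 1) :
    ∃ x y, Spanned F S x y := by
  have hcases := hF.card_fiber_cases hS
  obtain ⟨x, hx, hxS⟩ := hF.exists_even hS h1 one_ne_zero (card_pos.1 (by omega))
  obtain ⟨y, hy, hyS⟩ := hF.exists_even hS h1 two_ne_zero (card_pos.1 (by omega))
  exact ⟨x, y, hS, h0, h1, hx, hy, hxS, hyS⟩

lemma exists_mem_evens (hF : IsFamily F) (hS : S ∈ F) (h1 : 1 ∈ S) {c : ℕ} (hc : c = 1 ∨ c = 2)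
    (h4 : #(fiber c S) = 4) :
    #(fiber 0 S) = 3 ∧ ∃ u ∈ evens, ∃ m ∈ evens, 32 * c + u ∈ S ∧ m ∈ S := by
  have hcases := hF.card_fiber_cases hS
  have h3 : #(fiber 0 S) = 3 := by rcases hc with rfl | rfl <;> omega
  refine ⟨h3, ?_⟩
  obtain ⟨u, hu, huS⟩ := hF.exists_even hS h1 (c := c) (by omega) (card_pos.1 (by omega))
  refine ⟨u, hu, ?_⟩
  obtain ⟨n, hn, hn1⟩ := exists_mem_ne (s := fiber 0 S) (by omega) 1
  rw [mem_fiber] at hn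
  have hpos := hF.pos S hS n hn.1
  rcases Nat.mod_two_eq_zero_or_one n with h | h
  · exact ⟨n, mem_evens.2 ⟨h, hpos, by omega⟩, huS, hn.1⟩
  · have hmem := hF.xor_one_mem hS h1 hn.1 hn1
    rw [xor_one n (by omega), if_neg (by omega)] at hmem
    exact ⟨n - 1, mem_evens.2 ⟨by omega, hF.pos S hS _ hmem, by omega⟩, huS, hmem⟩

lemma blocked_notMem (hF : IsFamily F) (hcard : #{S ∈ F | 1 ∈ S ∧ #(fiber 0 S) = 1} = 7)
    (hS : S ∈ F) (hS1 : 1 ∈ S) (hS0 : #(fiber 0 S) = 3) {u m : ℕ} (hu : u < 32)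
    (hm : m < 32) (hm1 : m ≠ 1) (huS : 32 * 1 + u ∈ S) (hmS : m ∈ S) (hT : T ∈ F) (hT1 : 1 ∈ T)
    (hT4 : #(fiber 2 T) = 4) : blocked u m ∉ blockedReps := by
  classical
  intro hb
  obtain ⟨hT0, v, hv, n, hn, hvT, hnT⟩ := hF.exists_mem_evens hT hT1 (.inr rfl) hT4
  have hv' := mem_evens.1 hv
  have hn' := mem_evens.1 hn
  have hfree : ∀ {R x y}, Spanned F R x y → Nat.testBit (blocked u m) (x / 2) = false := by
    intro R x y h
    rw [blocked, testBit_mask, decide_eq_false_iff_not, List.mem_map]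
    rintro ⟨p, hp, hpx⟩
    exact hF.cls_ne hS h.mem h.one_mem one_ne_zero h.left_even h.left_mem
      (by rw [hS0, h.card_fiber]; norm_num)
      (hF.isFlag_of_mem_flags hS hS1 one_ne_zero hu hm hm1 huS hmS hp) hpx
  have hcount : evens.countP (fun x => decide (Nat.testBit (blocked u m) (x / 2) = false ∧
      ¬∃ y, ∃ R, Spanned F R x y)) ≤ 2 := by
    have hA := card_unblocked _ hb
    rw [← card_filter_add_card_filter_not (fun x => ∃ y, ∃ R, Spanned F R x y)] at hA
    have h7 : 7 ≤ #{x ∈ {x ∈ evens.toFinset | Nat.testBit (blocked u m) (x / 2) = false} |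
        ∃ y, ∃ R, Spanned F R x y} := by
      rw [← hcard]
      have hex : ∀ R ∈ ({R ∈ F | 1 ∈ R ∧ #(fiber 0 R) = 1} : Finset (Finset ℕ)),
          ∃ x y, Spanned F R x y := by
        intro R hR
        rw [mem_filter] at hR
        exact hF.exists_spanned hR.1 hR.2.1 hR.2.2
      choose! f g hfg using hex
      refine card_le_card_of_injOn f ?_ ?_
      · intro R hR
        have h := hfg R hR
        simp only [coe_filter, Set.mem_ofPred_eq, List.mem_toFinset, mem_filter]
        exact ⟨⟨h.left_even, hfree h⟩, _, _, h⟩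
      · intro R hR R' hR' h
        have hR := hfg R hR
        have hR' := hfg R' hR'
        exact hF.eq_of_mem R hR.mem R' hR'.mem 1 (32 * 1 + f R) (by omega) hR.one_mem hR.left_mem
          hR'.one_mem (h ▸ hR'.left_mem)
    have hnodup : evens.Nodup := by decide
    rw [List.countP_eq_length_filter, ← List.toFinset_card_of_nodup (hnodup.filter _)]
    refine (card_le_card (t := {x ∈ {x ∈ evens.toFinset |
      Nat.testBit (blocked u m) (x / 2) = false} | ¬∃ y, ∃ R, Spanned F R x y})
      fun x hx => ?_).trans (by omega)
    simpa only [List.mem_toFinset, List.mem_filter, decide_eq_true_eq, mem_filter, and_assoc]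
      using hx
  have hmask : mask ((flags v n).map fun p => 32 + cls p) ∈ blockedMasks := by
    refine List.mem_flatMap.2 ⟨v, hv, List.mem_map.2 ⟨n, List.mem_filter.2 ⟨hn, ?_⟩, rfl⟩⟩
    have hne := Bool.eq_false_iff.2 fun h =>
      hF.ne_of_add_mem hT two_ne_zero hv'.2.2 hvT hnT (Nat.eq_of_beq_eq_true h)
    simp only [hne, Bool.not_false]
  have htrue := search_eq_true (P := fun x y => ∃ R, Spanned F R x y) hmask ?_ ?_ ?_ evens
    (by decide) 2 0 hcount (Nat.and_zero _) fun _ _ _ _ => Nat.and_zero _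
  · rw [search_eq_false _ hb] at htrue
    exact Bool.false_ne_true htrue
  · rintro x y ⟨R, h⟩
    exact ⟨h.right_even, h.ne hF⟩
  · rintro x y x' y' ⟨R, h⟩ ⟨R', h'⟩ hne
    exact land_mask (h.bits_disjoint h' hF hne)
  · rintro x y ⟨R, h⟩
    refine land_mask fun i hi hi' => ?_
    obtain ⟨p, hp, rfl⟩ := List.mem_map.1 hi
    have hlt := cls_lt p
    have hz := mem_evens.1 (xor_mem_evens x h.left_even y h.right_even (h.ne hF))
    rcases h.exists_ratio hF hi' with ⟨X, Y, he, -, -⟩ | he | he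
    · have := ratio_lt X Y
      omega
    · exact hF.cls_ne hT h.mem h.one_mem two_ne_zero h.right_even h.right_mem
        (by rw [hT0, h.card_fiber]; norm_num)
        (hF.isFlag_of_mem_flags hT hT1 two_ne_zero hv'.2.2 hn'.2.2 (by omega) hvT hnT hp) (by omega)
    · omega

end IsFamily

/-- The Frobenius automorphism of `F₃₂` on the five low bits, read from a base-32 table. -/
def frob (n : ℕ) : ℕ :=
  n / 32 * 32 + 850225758731225616148925150155573904376942727200 / 32 ^ (n % 32) % 32

lemma frob_lt : ∀ n < 128, frob n < 128 := by decide +kernel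

lemma frob_pos : ∀ n < 128, 0 < n → 0 < frob n := by decide +kernel

lemma frob_period : ∀ n < 128, frob^[5] n = n := by decide +kernel

lemma frob_xor : ∀ a < 128, ∀ b < 128, frob (a ^^^ b) = frob a ^^^ frob b := by decide +kernel

lemma rot_frob : ∀ n < 128, rot (frob n) = frob (rot^[16] n) := by decide +kernel

lemma frob_div (n : ℕ) : frob n / 32 = n / 32 := by
  unfold frob
  omega

lemma frob_add : ∀ x < 32, frob (32 * 1 + x) = 32 * 1 + frob x := by decide +kernel

lemma frob_injOn {a b : ℕ} (ha : a < 128) (hb : b < 128) (h : frob a = frob b) : a = b := by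
  rw [← frob_period a ha, ← frob_period b hb]
  exact congrArg frob^[4] h

lemma exists_blocked_mem : ∀ u ∈ evens, ∀ m ∈ evens, u ≠ m →
    (∀ p ∈ flags u m, ∀ q ∈ flags u m, cls p = cls q → p.2 = q.2) →
    ∃ j < 5, blocked (frob^[j] u) (frob^[j] m) ∈ blockedReps := by
  decide +kernel

namespace IsFamily

variable {F : Finset (Finset ℕ)} {S : Finset ℕ}

lemma image_frob (hF : IsFamily F) : IsFamily (F.image (image frob)) := by
  have hinj : ∀ S ∈ F, ∀ T ∈ F, ∀ a ∈ S, ∀ b ∈ T, frob a = frob b → a = b :=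
    fun S hS T hT a ha b hb => frob_injOn (hF.lt S hS a ha) (hF.lt T hT b hb)
  constructor
  · intro S' hS' n' hn'
    obtain ⟨S, hS, rfl⟩ := mem_image.1 hS'
    obtain ⟨n, hn, rfl⟩ := mem_image.1 hn'
    exact frob_pos n (hF.lt S hS n hn) (hF.pos S hS n hn)
  · intro S' hS' n' hn'
    obtain ⟨S, hS, rfl⟩ := mem_image.1 hS'
    obtain ⟨n, hn, rfl⟩ := mem_image.1 hn'
    exact frob_lt n (hF.lt S hS n hn)
  · intro S' hS'
    obtain ⟨S, hS, rfl⟩ := mem_image.1 hS'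
    rw [card_image_of_injOn fun a ha b hb => hinj S hS S hS a ha b hb, hF.card_eq S hS]
  · intro S' hS' a' ha' b' hb' hab
    obtain ⟨S, hS, rfl⟩ := mem_image.1 hS'
    obtain ⟨a, ha, rfl⟩ := mem_image.1 ha'
    obtain ⟨b, hb, rfl⟩ := mem_image.1 hb'
    rw [← frob_xor a (hF.lt S hS a ha) b (hF.lt S hS b hb)]
    exact mem_image_of_mem _ (hF.xor_mem S hS a ha b hb fun h => hab (congrArg frob h))
  · intro S' hS'
    obtain ⟨S, hS, rfl⟩ := mem_image.1 hS'
    refine mem_image.2 ⟨_, hF.shift_mem hS 16, ?_⟩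
    rw [image_image, image_image]
    exact image_congr fun n hn => (rot_frob n (hF.lt S hS n hn)).symm
  · intro S' hS' T' hT' a' b' hab haS hbS haT hbT
    obtain ⟨S, hS, rfl⟩ := mem_image.1 hS'
    obtain ⟨T, hT, rfl⟩ := mem_image.1 hT'
    obtain ⟨a, ha, rfl⟩ := mem_image.1 haS
    obtain ⟨b, hb, rfl⟩ := mem_image.1 hbS
    obtain ⟨a₁, ha₁, haa⟩ := mem_image.1 haT
    obtain ⟨b₁, hb₁, hbb⟩ := mem_image.1 hbT
    obtain rfl := hinj T hT S hS a₁ ha₁ a ha haa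
    obtain rfl := hinj T hT S hS b₁ hb₁ b hb hbb
    rw [hF.eq_of_mem S hS T hT a₁ b₁ (fun h => hab (congrArg frob h)) ha hb ha₁ hb₁]

lemma card_image_frob (hF : IsFamily F) : #(F.image (image frob)) = #F := by
  refine card_image_of_injOn fun S hS T hT h => ?_
  have key : ∀ S ∈ F, ∀ T ∈ F, S.image frob = T.image frob → S ⊆ T := by
    intro S hS T hT h n hn
    obtain ⟨m, hm, he⟩ := mem_image.1 (h ▸ mem_image_of_mem frob hn)
    rwa [← frob_injOn (hF.lt T hT m hm) (hF.lt S hS n hn) he]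
  exact (key S hS T hT h).antisymm (key T hT S hS h.symm)

lemma card_fiber_image_frob (hF : IsFamily F) (hS : S ∈ F) (c : ℕ) :
    #(fiber c (S.image frob)) = #(fiber c S) := by
  have : fiber c (S.image frob) = (fiber c S).image frob := by
    ext n
    simp only [mem_fiber, mem_image]
    constructor
    · rintro ⟨⟨m, hm, rfl⟩, h⟩
      exact ⟨m, ⟨hm, by rwa [frob_div] at h⟩, rfl⟩
    · rintro ⟨m, ⟨hm, h⟩, rfl⟩
      exact ⟨⟨m, hm, rfl⟩, by rwa [frob_div]⟩
  rw [this, card_image_of_injOn]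
  intro a ha b hb
  exact frob_injOn (hF.lt S hS a (mem_fiber.1 ha).1) (hF.lt S hS b (mem_fiber.1 hb).1)

lemma blocked_iterate_notMem (hF : IsFamily F) (hcard : 279 < #F) (hS : S ∈ F) (hS1 : 1 ∈ S)
    (hS0 : #(fiber 0 S) = 3) {u m : ℕ} (hu : u < 32) (hm : m < 32) (hm1 : m ≠ 1)
    (huS : 32 * 1 + u ∈ S) (hmS : m ∈ S) (j : ℕ) :
    blocked (frob^[j] u) (frob^[j] m) ∉ blockedReps := by
  induction j generalizing F S u m with
  | zero =>
    obtain ⟨h7, -, T, hT, hT1, hT4⟩ := hF.types_of_card hcard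
    exact hF.blocked_notMem h7 hS hS1 hS0 hu hm hm1 huS hmS hT hT1 hT4
  | succ j ih =>
    have hone : frob 1 = 1 := by decide +kernel
    have hlt : ∀ x < 32, frob x < 32 := fun x hx => by
      have := frob_div x
      omega
    rw [Function.iterate_succ_apply, Function.iterate_succ_apply]
    refine ih hF.image_frob (by rwa [hF.card_image_frob]) (mem_image_of_mem _ hS)
      (mem_image.2 ⟨1, hS1, hone⟩) (by rwa [hF.card_fiber_image_frob hS]) (hlt u hu) (hlt m hm)
      (fun h => hm1 (frob_injOn (by omega) (by norm_num) (h.trans hone.symm))) ?_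
      (mem_image_of_mem _ hmS)
    rw [← frob_add u hu]
    exact mem_image_of_mem _ huS

theorem card_le (hF : IsFamily F) : #F ≤ 279 := by
  by_contra! hcard
  obtain ⟨-, ⟨S, hS, hS1, hS4⟩, -⟩ := hF.types_of_card hcard
  obtain ⟨hS0, u, hu, m, hm, huS, hmS⟩ := hF.exists_mem_evens hS hS1 (.inl rfl) hS4
  have hu' := mem_evens.1 hu
  have hm' := mem_evens.1 hm
  have hflag : ∀ p ∈ flags u m, IsFlag 1 S p := fun p hp =>
    hF.isFlag_of_mem_flags hS hS1 one_ne_zero hu'.2.2 hm'.2.2 (by omega) huS hmS hp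
  obtain ⟨j, -, hj⟩ := exists_blocked_mem u hu m hm
    (hF.ne_of_add_mem hS one_ne_zero hu'.2.2 huS hmS)
    fun p hp q hq => hF.snd_eq_of_cls_eq hS one_ne_zero (hflag p hp) (hflag q hq)
  exact hF.blocked_iterate_notMem hcard hS hS1 hS0 hu'.2.2 hm'.2.2 (by omega) huS hmS j hj

end IsFamily

/-- The vector whose coordinates are the binary digits of `n`. -/
def dec (n : ℕ) : V := fun i => if n.testBit i then 1 else 0

lemma dec_xor (a b : ℕ) : dec (a ^^^ b) = dec a + dec b := by
  funext i
  simp only [dec, Nat.testBit_xor, Pi.add_apply]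
  cases a.testBit i <;> cases b.testBit i <;> decide

lemma dec_zero : dec 0 = 0 := by
  funext i
  simp [dec]

lemma exists_dec : ∀ v : V, ∃ n < 128, dec n = v := by decide +kernel

lemma dec_injOn : ∀ a < 128, ∀ b < 128, dec a = dec b → a = b := by decide +kernel

open Classical in
/-- The codes of the nonzero vectors of `W`. -/
noncomputable def points (W : Submodule (ZMod 2) V) : Finset ℕ :=
  {n ∈ range 128 | n ≠ 0 ∧ dec n ∈ W}

lemma mem_points {W : Submodule (ZMod 2) V} {n : ℕ} :
    n ∈ points W ↔ n < 128 ∧ n ≠ 0 ∧ dec n ∈ W := by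
  simp [points]

lemma card_points (W : Submodule (ZMod 2) V) :
    #(points W) + 1 = 2 ^ Module.finrank (ZMod 2) W := by
  have h0 : 0 ∉ points W := by simp [mem_points]
  have hW : (((insert 0 (points W)).image dec : Finset V) : Set V) = W := by
    ext v
    simp only [coe_image, coe_insert, Set.mem_image, Set.mem_insert_iff, mem_points,
      SetLike.mem_coe]
    constructor
    · rintro ⟨n, rfl | h, rfl⟩
      · rw [dec_zero]
        exact W.zero_mem
      · exact h.2.2
    · intro hv
      obtain ⟨n, hn, rfl⟩ := exists_dec v
      exact ⟨n, by tauto, rfl⟩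
  have hcard : Nat.card W = #((insert 0 (points W)).image dec) := by
    rw [← Set.ncard_coe_finset, hW]
    rfl
  rw [← card_insert_of_notMem h0, ← card_image_of_injOn (f := dec), ← hcard,
    Module.natCard_eq_pow_finrank (K := ZMod 2), Nat.card_zmod]
  have hlt : ∀ n ∈ insert 0 (points W), n < 128 := by
    intro n hn
    rcases mem_insert.1 hn with rfl | hn
    · norm_num
    · exact (mem_points.1 hn).1
  exact fun a ha b hb => dec_injOn a (hlt a ha) b (hlt b hb)

lemma points_injective : Function.Injective points := by
  intro W W' h
  ext v
  obtain ⟨n, hn, rfl⟩ := exists_dec v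
  rcases eq_or_ne n 0 with rfl | h0
  · simp [dec_zero]
  · have h' : n ∈ points W ↔ n ∈ points W' := by rw [h]
    simpa [mem_points, hn, h0] using h'

lemma points_inf (W W' : Submodule (ZMod 2) V) : points (W ⊓ W') = points W ∩ points W' := by
  ext n
  simp only [mem_points, mem_inter, Submodule.mem_inf]
  tauto

/-- The matrix of `rot`. -/
def rotMatrix : Matrix (Fin 7) (Fin 7) (ZMod 2) := Matrix.of fun i j => dec (rot (2 ^ j.val)) i

lemma rotMatrix_mulVec : ∀ n < 128, rotMatrix.mulVec (dec n) = dec (rot n) := by decide +kernel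

lemma rotMatrix_pow_mulVec (k : ℕ) {n : ℕ} (hn : n < 128) :
    (rotMatrix ^ k).mulVec (dec n) = dec (rot^[k] n) := by
  induction k with
  | zero => simp
  | succ k ih =>
    rw [pow_succ', ← Matrix.mulVec_mulVec, ih, rotMatrix_mulVec _ (rot_iterate_lt hn k),
      Function.iterate_succ_apply']

lemma rotMatrix_pow : rotMatrix ^ 31 = 1 := by
  refine Matrix.mulVec_injective (funext fun v => ?_)
  obtain ⟨n, hn, rfl⟩ := exists_dec v
  rw [rotMatrix_pow_mulVec 31 hn, rot_iterate_period n hn, Matrix.one_mulVec]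

/-- The element of `GL(7, F₂)` given by `rot`. -/
noncomputable def rotGL : GL (Fin 7) (ZMod 2) :=
  Units.ofPowEqOne rotMatrix 31 rotMatrix_pow (by norm_num)

lemma orderOf_rotGL : orderOf rotGL = 31 := by
  have : Fact (Nat.Prime 31) := ⟨by norm_num⟩
  refine orderOf_eq_prime (Units.pow_ofPowEqOne _ _) fun h => ?_
  have h1 : rotMatrix = 1 := congrArg Units.val h
  have h2 := rotMatrix_mulVec 1 (by norm_num)
  rw [h1, Matrix.one_mulVec] at h2
  exact absurd (dec_injOn 1 (by norm_num) (rot 1) (rot_lt 1 (by norm_num)) h2) (by decide)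

lemma mem_smul {M : GL (Fin 7) (ZMod 2)} {W : Submodule (ZMod 2) V} {v : V} :
    v ∈ M • W ↔ ∃ w ∈ W, M.val.mulVec w = v :=
  Submodule.mem_map

lemma mulVecLin_injective (M : GL (Fin 7) (ZMod 2)) : Function.Injective M.val.mulVecLin :=
  Matrix.mulVec_injective_of_isUnit M.isUnit

lemma finrank_smul (M : GL (Fin 7) (ZMod 2)) (W : Submodule (ZMod 2) V) :
    Module.finrank (ZMod 2) ↥(M • W) = Module.finrank (ZMod 2) W :=
  (Submodule.equivMapOfInjective _ (mulVecLin_injective M) W).finrank_eq.symm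

lemma smul_inf (M : GL (Fin 7) (ZMod 2)) (W W' : Submodule (ZMod 2) V) :
    M • (W ⊓ W') = M • W ⊓ M • W' :=
  Submodule.map_inf _ (mulVecLin_injective M)

lemma points_rotGL_smul (W : Submodule (ZMod 2) V) : points (rotGL • W) = (points W).image rot := by
  ext n
  simp only [mem_points, mem_image, mem_smul]
  constructor
  · rintro ⟨hn, hn0, w, hw, h⟩
    obtain ⟨m, hm, rfl⟩ := exists_dec w
    have hmn : rot m = n :=
      dec_injOn _ (rot_lt m hm) _ hn ((rotMatrix_mulVec m hm).symm.trans h)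
    refine ⟨m, ⟨hm, ?_, hw⟩, hmn⟩
    rintro rfl
    exact hn0 hmn.symm
  · rintro ⟨m, ⟨hm, hm0, hw⟩, rfl⟩
    exact ⟨rot_lt m hm, (rot_pos m hm (Nat.pos_of_ne_zero hm0)).ne', _, hw, rotMatrix_mulVec m hm⟩

lemma points_rotGL_pow_smul (k : ℕ) (W : Submodule (ZMod 2) V) :
    points (rotGL ^ k • W) = (points W).image rot^[k] := by
  induction k with
  | zero => simp
  | succ k ih =>
    rw [pow_succ', mul_smul, points_rotGL_smul, ih, image_image, Function.iterate_succ']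

lemma isFamily_points {C : Set (Submodule (ZMod 2) V)} (hC : IsCode C)
    (hrot : ∀ W ∈ C, rotGL • W ∈ C) : IsFamily (C.toFinite.toFinset.image points) := by
  have hmem : ∀ {S}, S ∈ C.toFinite.toFinset.image points ↔ ∃ W ∈ C, points W = S := by
    simp
  constructor
  · intro S hS n hn
    obtain ⟨W, hW, rfl⟩ := hmem.1 hS
    exact Nat.pos_of_ne_zero (mem_points.1 hn).2.1
  · intro S hS n hn
    obtain ⟨W, hW, rfl⟩ := hmem.1 hS
    exact (mem_points.1 hn).1
  · intro S hS
    obtain ⟨W, hW, rfl⟩ := hmem.1 hS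
    have := card_points W
    rw [hC.1 W hW] at this
    omega
  · intro S hS a ha b hb hab
    obtain ⟨W, hW, rfl⟩ := hmem.1 hS
    rw [mem_points] at ha hb ⊢
    refine ⟨Nat.xor_lt_two_pow (n := 7) ha.1 hb.1, fun h => hab (Nat.xor_eq_zero_iff.1 h), ?_⟩
    rw [dec_xor]
    exact W.add_mem ha.2.2 hb.2.2
  · intro S hS
    obtain ⟨W, hW, rfl⟩ := hmem.1 hS
    exact hmem.2 ⟨_, hrot W hW, points_rotGL_smul W⟩
  · intro S hS T hT a b hab haS hbS haT hbT
    obtain ⟨W, hW, rfl⟩ := hmem.1 hS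
    obtain ⟨W', hW', rfl⟩ := hmem.1 hT
    by_contra hne
    have hdim := hC.2 W hW W' hW' fun h => hne (congrArg points h)
    have hcard := card_points (W ⊓ W')
    have hpow := Nat.pow_le_pow_right (n := 2) (by norm_num) hdim
    have hle : #(points (W ⊓ W')) ≤ 1 := by omega
    rw [points_inf] at hle
    exact hab (card_le_one.1 hle a (mem_inter.2 ⟨haS, haT⟩) b (mem_inter.2 ⟨hbS, hbT⟩))

theorem ncard_le_of_rotGL_smul_mem {C : Set (Submodule (ZMod 2) V)} (hC : IsCode C)
    (hrot : ∀ W ∈ C, rotGL • W ∈ C) : C.ncard ≤ 279 := by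
  rw [Set.ncard_eq_toFinset_card C, ← card_image_of_injective _ points_injective]
  exact (isFamily_points hC hrot).card_le

open Pointwise in
lemma exists_conj_eq_rotGL {U : Subgroup (GL (Fin 7) (ZMod 2))} (hU : Nat.card U = 31) :
    ∃ g, ∃ M ∈ U, g * M * g⁻¹ = rotGL := by
  have : Fact (Nat.Prime 31) := ⟨by norm_num⟩
  have hfac : 31 ^ (Nat.card (GL (Fin 7) (ZMod 2))).factorization 31 = 31 := by
    have hcard : Nat.card (GL (Fin 7) (ZMod 2)) = 31 * 5285483642880 := by
      rw [Matrix.card_GL_field]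
      simp [Fin.prod_univ_succ, ZMod.card]
    rw [hcard, Nat.factorization_eq_of_coprime_left (by norm_num) (by norm_num),
      Nat.Prime.factorization_self (by norm_num), pow_one]
  obtain ⟨g, hg⟩ := MulAction.exists_smul_eq (GL (Fin 7) (ZMod 2))
    (Sylow.ofCard (p := 31) U (by rw [hU, hfac]))
    (Sylow.ofCard (p := 31) (Subgroup.zpowers rotGL)
      (by rw [Nat.card_zpowers, orderOf_rotGL, hfac]))
  have hmem : rotGL ∈ MulAut.conj g • U := by
    have := congrArg Sylow.toSubgroup hg
    simp only [Sylow.coe_subgroup_smul, Sylow.coe_ofCard] at this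
    rw [this]
    exact Subgroup.mem_zpowers rotGL
  obtain ⟨M, hM, h⟩ := hmem
  exact ⟨g, M, hM, h⟩

theorem ncard_le {U : Subgroup (GL (Fin 7) (ZMod 2))} (hU : Nat.card U = 31)
    {C : Set (Submodule (ZMod 2) V)} (hC : IsCode C) (hinv : Invariant U C) : C.ncard ≤ 279 := by
  obtain ⟨g, M, hM, hg⟩ := exists_conj_eq_rotGL hU
  rw [← Set.ncard_image_of_injective C (MulAction.injective g)]
  refine ncard_le_of_rotGL_smul_mem ⟨?_, ?_⟩ ?_
  · rintro _ ⟨W, hW, rfl⟩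
    exact (finrank_smul g W).trans (hC.1 W hW)
  · rintro _ ⟨W, hW, rfl⟩ _ ⟨W', hW', rfl⟩ hne
    dsimp only at hne ⊢
    rw [← smul_inf, finrank_smul]
    exact hC.2 W hW W' hW' fun h => hne (congrArg _ h)
  · rintro _ ⟨W, hW, rfl⟩
    refine ⟨M • W, hinv M hM W hW, ?_⟩
    dsimp only
    rw [← hg, ← mul_smul, ← mul_smul, inv_mul_cancel_right]

/-- The codes of the vectors of the representatives of the orbits of a code with `279` members. -/
def base (t : Fin 9) : Finset ℕ :=
  let p : ℕ × ℕ := ![(20, 102), (4, 66), (6, 48), (60, 84), (56, 76), (34, 72), (36, 94), (40, 80),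
    (44, 78)] t
  {0, 1, p.1, p.2, 1 ^^^ p.1, 1 ^^^ p.2, p.1 ^^^ p.2, 1 ^^^ p.1 ^^^ p.2}

lemma zero_mem_base : ∀ t, 0 ∈ base t := by decide +kernel

lemma lt_of_mem_base : ∀ t, ∀ n ∈ base t, n < 128 := by decide +kernel

lemma card_base : ∀ t, #(base t) = 8 := by decide +kernel

lemma xor_mem_base : ∀ t, ∀ a ∈ base t, ∀ b ∈ base t, a ^^^ b ∈ base t := by decide +kernel

lemma card_base_inter : ∀ t t' : Fin 9, ∀ k < 31, (k = 0 ∧ t = t') ∨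
    #((base t).erase 0 ∩ ((base t').erase 0).image rot^[k]) ≤ 1 := by decide +kernel

/-- The subspace with vectors `base t`. -/
def baseSpace (t : Fin 9) : Submodule (ZMod 2) V where
  carrier := {v | ∃ n ∈ base t, dec n = v}
  zero_mem' := ⟨0, zero_mem_base t, dec_zero⟩
  add_mem' := by
    rintro _ _ ⟨a, ha, rfl⟩ ⟨b, hb, rfl⟩
    exact ⟨a ^^^ b, xor_mem_base t a ha b hb, dec_xor a b⟩
  smul_mem' := by
    rintro c _ ⟨a, ha, rfl⟩
    have hc : ∀ c : ZMod 2, c = 0 ∨ c = 1 := by decide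
    rcases hc c with rfl | rfl
    · exact ⟨0, zero_mem_base t, by rw [dec_zero, zero_smul]⟩
    · exact ⟨a, ha, (one_smul _ _).symm⟩

lemma points_baseSpace (t : Fin 9) : points (baseSpace t) = (base t).erase 0 := by
  ext n
  rw [mem_points, mem_erase]
  constructor
  · rintro ⟨hn, hn0, m, hm, h⟩
    rw [← dec_injOn m (lt_of_mem_base t m hm) n hn h]
    exact ⟨by rintro rfl; exact hn0 (dec_injOn 0 (by norm_num) n hn h).symm, hm⟩
  · rintro ⟨hn0, hn⟩
    exact ⟨lt_of_mem_base t n hn, hn0, n, hn, rfl⟩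

lemma finrank_baseSpace (t : Fin 9) : Module.finrank (ZMod 2) (baseSpace t) = 3 := by
  have h := card_points (baseSpace t)
  rw [points_baseSpace, card_erase_of_mem (zero_mem_base t), card_base] at h
  exact (Nat.pow_right_injective le_rfl (h : 2 ^ 3 = _)).symm

/-- The members of the code generated by `baseSpace`. -/
noncomputable def codeword (p : Subgroup.zpowers rotGL × Fin 9) : Submodule (ZMod 2) V :=
  p.1.val • baseSpace p.2

lemma smul_codeword (M : Subgroup.zpowers rotGL) (p : Subgroup.zpowers rotGL × Fin 9) :
    M.val • codeword p = codeword (M * p.1, p.2) := by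
  rw [codeword, codeword, Subgroup.coe_mul, mul_smul]

lemma finrank_codeword (p : Subgroup.zpowers rotGL × Fin 9) :
    Module.finrank (ZMod 2) (codeword p) = 3 :=
  (finrank_smul _ _).trans (finrank_baseSpace _)

lemma finrank_codeword_inf {p q : Subgroup.zpowers rotGL × Fin 9} (hpq : p ≠ q) :
    Module.finrank (ZMod 2) ↥(codeword p ⊓ codeword q) ≤ 1 := by
  classical
  obtain ⟨k, hk, hpow⟩ : ∃ k < 31, rotGL ^ k = (p.1⁻¹ * q.1).val := by
    have h := mem_zpowers_iff_mem_range_orderOf.1 (p.1⁻¹ * q.1).2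
    simpa [orderOf_rotGL] using h
  have hq : codeword q = p.1.val • rotGL ^ k • baseSpace q.2 := by
    rw [hpow, ← mul_smul, codeword]
    simp
  rw [hq, codeword, ← smul_inf, finrank_smul]
  rcases card_base_inter p.2 q.2 k hk with ⟨rfl, h2⟩ | h
  · refine absurd (Prod.ext ?_ h2) hpq
    rw [pow_zero] at hpow
    have hone : p.1⁻¹ * q.1 = 1 := Subtype.ext hpow.symm
    exact inv_mul_eq_one.1 hone
  · rw [← points_baseSpace, ← points_baseSpace, ← points_rotGL_pow_smul, ← points_inf] at h
    have hcard := card_points (baseSpace p.2 ⊓ rotGL ^ k • baseSpace q.2)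
    by_contra! h2
    have := Nat.pow_le_pow_right (n := 2) (by norm_num) h2
    omega

lemma codeword_injective : Function.Injective codeword := by
  intro p q h
  by_contra hpq
  have := finrank_codeword_inf hpq
  rw [h, inf_idem, finrank_codeword] at this
  omega

end InvariantCode

/-- A `(7,4;3)₂` code invariant under a subgroup of order 31 has at most 279 codewords,
and this bound is attained. -/
theorem stmt_14 :
    (∀ (U : Subgroup (GL (Fin 7) (ZMod 2))), Nat.card U = 31 →
      ∀ C : Set (Submodule (ZMod 2) V), IsCode C → Invariant U C → C.ncard ≤ 279) ∧
    (∃ (U : Subgroup (GL (Fin 7) (ZMod 2))) (C : Set (Submodule (ZMod 2) V)),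
      Nat.card U = 31 ∧ IsCode C ∧ Invariant U C ∧ C.ncard = 279) := by
  have hcard : Nat.card (Subgroup.zpowers InvariantCode.rotGL) = 31 := by
    rw [Nat.card_zpowers, InvariantCode.orderOf_rotGL]
  refine ⟨fun U hU C hC hinv => InvariantCode.ncard_le hU hC hinv,
    Subgroup.zpowers InvariantCode.rotGL, Set.range InvariantCode.codeword, hcard, ⟨?_, ?_⟩, ?_, ?_⟩
  · rintro _ ⟨p, rfl⟩
    exact InvariantCode.finrank_codeword p
  · rintro _ ⟨p, rfl⟩ _ ⟨q, rfl⟩ hne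
    exact InvariantCode.finrank_codeword_inf fun h => hne (congrArg _ h)
  · rintro M hM _ ⟨p, rfl⟩
    exact ⟨_, (InvariantCode.smul_codeword ⟨M, hM⟩ p).symm⟩
  · rw [Set.ncard_range_of_injective InvariantCode.codeword_injective, Nat.card_prod, hcard,
      Nat.card_fin]
end
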